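/- For each n ≥ 1 let p_n be a probability distribution on the positive integers and X_n a random variable with distribution p_n; assume μ_n := E[log X_n] and σ_n² := Var(log X_n) satisfy 0 < μ_n < ∞ and 0 < σ_n < ∞, set ξ_n = (log X_n − μ_n)/σ_n, and assume the Lindeberg-type condition: for every ε > 0, lim_{n→∞} E[ξ_n²·1{ξ_n² > ε·(log n)/μ_n}] = 0. Set t_n = (3·log n)/(2·μ_n) and b_n = (1/μ_n)·max{(μ_n + σ_n)·√((log n)/μ_n), 1}, and let H_{n,t} be the continuous-time p_n-shuffle distribution. Then b_n/t_n → 0, lim_{c→+∞} limsup_{n→∞} ‖H_{n, t_n + c·b_n} − U_n‖_TV = 0, lim_{c→+∞} liminf_{n→∞} ‖H_{n, max(t_n − c·b_n, 0)} − U_n‖_TV = 1, and the cutoff is optimal: for every c > 0, liminf_{n→∞} ‖H_{n, t_n + c·b_n} − U_n‖_TV > 0 and limsup_{n→∞} ‖H_{n, max(t_n − c·b_n, 0)} − U_n‖_TV < 1. -/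

import Mathlib

open Filter MeasureTheory
open scoped BigOperators NNReal ENNReal

noncomputable section

/-- The value of `σ⁻¹` at position `i` (0-indexed), as a natural number; `0` out of range. -/
def invAt (n : ℕ) (σ : Equiv.Perm (Fin n)) (i : ℕ) : ℕ :=
  if h : i < n then ((σ⁻¹ ⟨i, h⟩ : Fin n) : ℕ) else 0

/-- The number of rising sequences of a permutation: one plus the number of descents
of its inverse. -/
def rSeq (n : ℕ) (σ : Equiv.Perm (Fin n)) : ℕ :=
  1 + ((Finset.range (n - 1)).filter fun i => invAt n σ (i + 1) < invAt n σ i).card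

/-- The `m`-shuffle distribution on `S_n`:  `Q_{n,m}(σ) = m^{-n} C(n + m - r(σ), n)`. -/
def Qs (n m : ℕ) (σ : Equiv.Perm (Fin n)) : ℝ :=
  ((m : ℝ) ^ n)⁻¹ * (Nat.choose (n + m - rSeq n σ) n : ℝ)

/-- The uniform distribution on `S_n`. -/
def Us (n : ℕ) (_ : Equiv.Perm (Fin n)) : ℝ := (n.factorial : ℝ)⁻¹

/-- Total variation distance between two probability distributions on `S_n`. -/
def tv (n : ℕ) (μ ν : Equiv.Perm (Fin n) → ℝ) : ℝ :=
  (1 / 2) * ∑ σ : Equiv.Perm (Fin n), |μ σ - ν σ|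

/-- Convolution of two distributions on `S_n`. -/
def convol (n : ℕ) (μ ν : Equiv.Perm (Fin n) → ℝ) : Equiv.Perm (Fin n) → ℝ :=
  fun σ => ∑ τ : Equiv.Perm (Fin n), μ (σ * τ⁻¹) * ν τ

/-- `k`-fold convolution power; the `0`-th power is the point mass at the identity. -/
def iterConv (n : ℕ) (μ : Equiv.Perm (Fin n) → ℝ) : ℕ → Equiv.Perm (Fin n) → ℝ
  | 0 => fun σ => if σ = 1 then 1 else 0
  | k + 1 => convol n μ (iterConv n μ k)

/-- `Ψ(x) = (2π)^{-1/2} ∫_{-x/(4√3)}^{x/(4√3)} e^{-t²/2} dt`. -/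
def Psi (x : ℝ) : ℝ :=
  (Real.sqrt (2 * Real.pi))⁻¹ *
    ∫ t in (-(x / (4 * Real.sqrt 3)))..(x / (4 * Real.sqrt 3)), Real.exp (-t ^ 2 / 2)

/-- The `p`-shuffle distribution on `S_n` for a probability `p` on the positive integers. -/
def Qp (n : ℕ) (p : ℕ → ℝ) (σ : Equiv.Perm (Fin n)) : ℝ := ∑' m : ℕ, p m * Qs n m σ

/-- Continuous-time `p`-shuffle distribution at time `t`:
`H_{n,t}(σ) = e^{-t} Σ_k (t^k/k!) Q_{n,p}^k(σ)`. -/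
def Hp (n : ℕ) (p : ℕ → ℝ) (t : ℝ) (σ : Equiv.Perm (Fin n)) : ℝ :=
  Real.exp (-t) * ∑' k : ℕ, t ^ k / (k.factorial : ℝ) * iterConv n (Qp n p) k σ

/-- The pairs `(f i, g i)` are strictly increasing for the lexicographic order. -/
def LexMono {n : ℕ} {A B : Type*} [LT A] [LT B] (f : Fin n → A) (g : Fin n → B) : Prop :=
  ∀ i j, i < j → f i < f j ∨ f i = f j ∧ g i < g j

/-- The fillings `f` of `Fin n` by letters of an alphabet `A` whose standardization is the
permutation `σ`, listed in increasing order of the letters. -/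
abbrev Fillings (n : ℕ) (A : Type*) [LinearOrder A] (σ : Equiv.Perm (Fin n)) : Type _ :=
  {f : Fin n → A // LexMono f ⇑σ⁻¹}

theorem toLex_perm_injective {n : ℕ} {A : Type*} (g : Fin n → A) (σ : Equiv.Perm (Fin n)) :
    Function.Injective fun i => toLex (g i, σ i) := by
  intro i j h
  have : (g i, σ i) = (g j, σ j) := toLex.injective h
  exact σ.injective (Prod.ext_iff.1 this).2

theorem exists_perm_lexMono {n : ℕ} {A : Type*} [LinearOrder A] (f : Fin n → A)
    (g : Equiv.Perm (Fin n)) :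
    ∃ ρ : Equiv.Perm (Fin n), LexMono (f ∘ ρ) (g ∘ ρ) := by
  have h := Tuple.monotone_sort fun i => toLex (f i, g i)
  have h' := h.strictMono_of_injective ((toLex_perm_injective f g).comp (Equiv.injective _))
  exact ⟨_, fun i j hij => Prod.Lex.toLex_lt_toLex.1 (h' hij)⟩

theorem perm_eq_of_lexMono {n : ℕ} {A : Type*} [LinearOrder A] (f : Fin n → A)
    (g : Equiv.Perm (Fin n)) {ρ ρ' : Equiv.Perm (Fin n)} (h : LexMono (f ∘ ρ) (g ∘ ρ))
    (h' : LexMono (f ∘ ρ') (g ∘ ρ')) : ρ = ρ' := by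
  have h1 : StrictMono ((fun i => toLex (f i, g i)) ∘ ρ) :=
    fun i j hij => Prod.Lex.toLex_lt_toLex.2 (h i j hij)
  have h2 : StrictMono ((fun i => toLex (f i, g i)) ∘ ρ') :=
    fun i j hij => Prod.Lex.toLex_lt_toLex.2 (h' i j hij)
  have := Tuple.unique_monotone h1.monotone h2.monotone
  ext i
  rw [toLex_perm_injective f g (congrFun this i)]

theorem LexMono.symm_lt {n : ℕ} {A : Type*} [LinearOrder A] {f : Fin n → A}
    {g ρ : Equiv.Perm (Fin n)} (h : LexMono (f ∘ ρ) (g ∘ ρ)) {i j : Fin n}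
    (hij : f i < f j ∨ f i = f j ∧ g i < g j) : ρ⁻¹ i < ρ⁻¹ j := by
  by_contra! hle
  have e : ∀ i, ρ (ρ⁻¹ i) = i := fun i => by simp
  rcases hle.lt_or_eq with hlt | heq
  · have := h _ _ hlt
    simp only [Function.comp_apply, e] at this
    rcases hij with h1 | ⟨h1, h2⟩ <;> rcases this with h3 | ⟨h3, h4⟩
    · exact absurd h1 h3.asymm
    · exact absurd h3 h1.ne'
    · exact absurd h1 h3.ne'
    · exact absurd h2 h4.asymm
  · have : i = j := (ρ⁻¹).injective heq.symm
    subst this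
    simp at hij

/-- Fillings with values in a lexicographic product split as a pair of fillings. -/
theorem card_fillings_prod (n : ℕ) (A B : Type*) [LinearOrder A] [LinearOrder B] [Finite A]
    [Finite B] (σ : Equiv.Perm (Fin n)) :
    Nat.card (Fillings n (A ×ₗ B) σ) =
      ∑ τ : Equiv.Perm (Fin n), Nat.card (Fillings n A (σ * τ⁻¹)) * Nat.card (Fillings n B τ) := by
  have key : Function.Bijective
      (fun x : (Σ τ : Equiv.Perm (Fin n), Fillings n A (σ * τ⁻¹) × Fillings n B τ) =>
        (⟨fun i => toLex (x.2.1.1 i, x.2.2.1 ((σ * x.1⁻¹)⁻¹ i)), by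
          obtain ⟨τ, ⟨f, hf⟩, ⟨g, hg⟩⟩ := x
          intro i j hij
          rcases hf i j hij with h | ⟨h1, h2⟩
          · exact Or.inl (Prod.Lex.toLex_lt_toLex.2 (Or.inl h))
          · have := hg _ _ h2
            rcases this with h | ⟨h3, h4⟩
            · exact Or.inl (Prod.Lex.toLex_lt_toLex.2 (Or.inr ⟨h1, h⟩))
            · exact Or.inr ⟨congrArg₂ (fun a b => toLex (a, b)) h1 h3, by simpa using h4⟩⟩ :
              Fillings n (A ×ₗ B) σ)) := by
    constructor
    · rintro ⟨τ, ⟨f, hf⟩, ⟨g, hg⟩⟩ ⟨τ', ⟨f', hf'⟩, ⟨g', hg'⟩⟩ h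
      have h' := fun i => Prod.ext_iff.1 (toLex.injective (congrFun (congrArg Subtype.val h) i))
      have h1 : f = f' := funext fun i => (h' i).1
      have h2 : ∀ i, g ((σ * τ⁻¹)⁻¹ i) = g' ((σ * τ'⁻¹)⁻¹ i) := fun i => (h' i).2
      have hρ : σ * τ⁻¹ = σ * τ'⁻¹ := by
        refine perm_eq_of_lexMono (fun i => g ((σ * τ⁻¹)⁻¹ i)) σ⁻¹ ?_ ?_
        · convert hg using 1 <;> funext i <;> simp
        · simp_rw [h2]
          convert hg' using 1 <;> funext i <;> simp
      have hτ : τ = τ' := by simpa using hρ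
      subst hτ
      have h3 : g = g' := by
        funext i
        have := h2 ((σ * τ⁻¹) i)
        simpa using this
      subst h1 h3
      rfl
    · rintro ⟨h, hh⟩
      obtain ⟨ρ, hρ⟩ := exists_perm_lexMono (fun i => (ofLex (h i)).2) σ⁻¹
      refine ⟨⟨ρ⁻¹ * σ, ⟨fun i => (ofLex (h i)).1, ?_⟩, ⟨fun i => (ofLex (h (ρ i))).2, ?_⟩⟩, ?_⟩
      · intro i j hij
        simp only [mul_inv_rev, inv_inv, mul_inv_cancel_left]
        rcases hh i j hij with h1 | ⟨h1, h2⟩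
        · rw [Prod.Lex.lt_iff] at h1
          rcases h1 with h1 | ⟨h1, h2⟩
          · exact Or.inl h1
          · exact Or.inr ⟨h1, hρ.symm_lt (Or.inl h2)⟩
        · exact Or.inr ⟨by rw [h1], hρ.symm_lt (Or.inr ⟨by rw [h1], h2⟩)⟩
      · convert hρ using 1 <;> funext i <;> simp
      · apply Subtype.ext
        funext i
        simp
  rw [← Nat.card_eq_of_bijective _ key, Nat.card_sigma]
  simp [Nat.card_prod]

/-- Every word is the filling of exactly one permutation. -/
theorem sum_card_fillings (n : ℕ) (A : Type*) [LinearOrder A] [Finite A] :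
    ∑ σ : Equiv.Perm (Fin n), Nat.card (Fillings n A σ) = Nat.card A ^ n := by
  have key : Function.Bijective
      (fun x : (Σ τ : Equiv.Perm (Fin n), Fillings n A τ) => fun i => x.2.1 (x.1 i)) := by
    constructor
    · rintro ⟨τ, ⟨f, hf⟩⟩ ⟨τ', ⟨f', hf'⟩⟩ h
      have h' : ∀ i, f (τ i) = f' (τ' i) := fun i => congrFun h i
      have hτ : τ⁻¹ = τ'⁻¹ := by
        refine perm_eq_of_lexMono (fun i => f (τ i)) 1 ?_ ?_
        · convert hf using 1 <;> funext i <;> simp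
        · simp_rw [h']
          convert hf' using 1 <;> funext i <;> simp
      have hτ : τ = τ' := by simpa using hτ
      subst hτ
      have : f = f' := by
        funext i
        simpa using h' (τ⁻¹ i)
      subst this
      rfl
    · intro w
      obtain ⟨ρ, hρ⟩ := exists_perm_lexMono w 1
      refine ⟨⟨ρ⁻¹, ⟨fun i => w (ρ i), ?_⟩⟩, ?_⟩
      · convert hρ using 1 <;> funext i <;> simp
      · funext i; simp
  have := Nat.card_eq_of_bijective _ key
  rw [Nat.card_sigma, Nat.card_fun] at this
  simpa using this

theorem card_strictMono_fin (n N : ℕ) :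
    Nat.card {g : Fin n → Fin N // StrictMono g} = N.choose n := by
  have e : {g : Fin n → Fin N // StrictMono g} ≃ (Fin n ↪o Fin N) :=
    { toFun := fun g => OrderEmbedding.ofStrictMono g.1 g.2
      invFun := fun g => ⟨g, g.strictMono⟩
      left_inv := fun g => rfl
      right_inv := fun g => by ext; rfl }
  rw [Nat.card_congr (e.trans Set.powersetCard.ofFinEmbEquiv), Set.powersetCard.card]
  simp

theorem card_fillings_congr (n : ℕ) {A B : Type*} [LinearOrder A] [LinearOrder B]
    (e : A ≃o B) (σ : Equiv.Perm (Fin n)) :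
    Nat.card (Fillings n A σ) = Nat.card (Fillings n B σ) := by
  refine Nat.card_congr ⟨fun f => ⟨fun i => e (f.1 i), ?_⟩, fun f => ⟨fun i => e.symm (f.1 i), ?_⟩,
    fun f => Subtype.ext (by simp), fun f => Subtype.ext (by simp)⟩
  · simpa [LexMono] using f.2
  · simpa [LexMono] using f.2

theorem strictMono_fin_add_le {n : ℕ} {F : Fin n → ℕ} (hF : StrictMono F) {i j : Fin n}
    (hij : i ≤ j) : F i + (j - i : ℕ) ≤ F j := by
  obtain ⟨i, hi⟩ := i
  obtain ⟨j, hj⟩ := j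
  obtain ⟨d, rfl⟩ := Nat.exists_eq_add_of_le (show i ≤ j from hij)
  simp only [Nat.add_sub_cancel_left]
  clear hij
  induction d with
  | zero => simp
  | succ d ih =>
    have h1 := ih (by omega)
    have h2 : F ⟨i + d, by omega⟩ < F ⟨i + (d + 1), hj⟩ := hF (by simp)
    omega

/-- The number of ascents of `σ⁻¹` before position `i`. -/
def ascCount (n : ℕ) (σ : Equiv.Perm (Fin n)) (i : ℕ) : ℕ :=
  ((Finset.range i).filter fun j => ¬ invAt n σ (j + 1) < invAt n σ j).card

theorem ascCount_succ (n : ℕ) (σ : Equiv.Perm (Fin n)) (i : ℕ) :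
    ascCount n σ (i + 1) =
      ascCount n σ i + if invAt n σ (i + 1) < invAt n σ i then 0 else 1 := by
  unfold ascCount
  rw [Finset.range_add_one, Finset.filter_insert]
  by_cases h : invAt n σ (i + 1) < invAt n σ i
  · simp [h]
  · simp only [h, not_false_eq_true, if_true, if_false]
    rw [Finset.card_insert_of_notMem (by simp)]

theorem ascCount_le (n : ℕ) (σ : Equiv.Perm (Fin n)) (i : ℕ) : ascCount n σ i ≤ i :=
  (Finset.card_filter_le _ _).trans (by simp)

theorem ascCount_le_add (n : ℕ) (σ : Equiv.Perm (Fin n)) {i j : ℕ} (hij : i ≤ j) :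
    ascCount n σ j ≤ ascCount n σ i + (j - i) := by
  obtain ⟨d, rfl⟩ := Nat.exists_eq_add_of_le hij
  induction d with
  | zero => simp
  | succ d ih =>
    have := ascCount_succ n σ (i + d)
    have := ih (by omega)
    rw [← add_assoc]
    split_ifs at * <;> omega

theorem ascCount_add_rSeq (n : ℕ) (σ : Equiv.Perm (Fin n)) :
    ascCount n σ (n - 1) + rSeq n σ = 1 + (n - 1) := by
  have := Finset.card_filter_add_card_filter_not (s := Finset.range (n - 1))
    (fun i => invAt n σ (i + 1) < invAt n σ i)
  simp only [Finset.card_range] at this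
  unfold ascCount rSeq
  omega

theorem rSeq_pos (n : ℕ) (σ : Equiv.Perm (Fin n)) : 1 ≤ rSeq n σ := by
  unfold rSeq; omega

theorem rSeq_le {n : ℕ} (hn : 1 ≤ n) (σ : Equiv.Perm (Fin n)) : rSeq n σ ≤ n := by
  have := ascCount_add_rSeq n σ
  omega

theorem lexMono_iff_strictMono {k : ℕ} (σ : Equiv.Perm (Fin (k + 1))) {m : ℕ}
    (f : Fin (k + 1) → Fin m) :
    LexMono f ⇑σ⁻¹ ↔ StrictMono fun i => (f i : ℕ) + ascCount (k + 1) σ i := by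
  have h1 : LexMono f ⇑σ⁻¹ ↔ StrictMono fun i => toLex (f i, σ⁻¹ i) := by
    simp only [LexMono, StrictMono, Prod.Lex.toLex_lt_toLex]
  rw [h1, Fin.strictMono_iff_lt_succ, Fin.strictMono_iff_lt_succ]
  refine forall_congr' fun i => ?_
  rw [Prod.Lex.toLex_lt_toLex]
  have h2 := ascCount_succ (k + 1) σ i
  have h3 : invAt (k + 1) σ i = (σ⁻¹ i.castSucc : Fin (k + 1)) := by
    unfold invAt
    rw [dif_pos (by omega)]; rfl
  have h4 : invAt (k + 1) σ (i + 1) = (σ⁻¹ i.succ : Fin (k + 1)) := by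
    unfold invAt
    rw [dif_pos (by omega)]; rfl
  have h5 : σ⁻¹ i.castSucc ≠ σ⁻¹ i.succ := by
    simp [Fin.ext_iff]
  rw [h3, h4] at h2
  rw [Fin.lt_def, Fin.ext_iff, Fin.lt_def]
  rw [Ne, Fin.ext_iff] at h5
  simp only [Fin.val_succ, Fin.val_castSucc, h2]
  split_ifs at * <;> omega

theorem card_fillings_fin {n : ℕ} (hn : 1 ≤ n) (m : ℕ) (σ : Equiv.Perm (Fin n)) :
    Nat.card (Fillings n (Fin m) σ) = (n + m - rSeq n σ).choose n := by
  obtain ⟨k, rfl⟩ : ∃ k, n = k + 1 := ⟨n - 1, by omega⟩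
  have hr := ascCount_add_rSeq (k + 1) σ
  simp only [Nat.add_sub_cancel] at hr
  rw [← card_strictMono_fin]
  have hlast : ∀ i : Fin (k + 1), i ≤ Fin.last k := Fin.le_last
  refine Nat.card_congr
    { toFun := fun f => ⟨fun i => ⟨(f.1 i : ℕ) + ascCount (k + 1) σ i, ?_⟩, ?_⟩
      invFun := fun g => ⟨fun i => ⟨(g.1 i : ℕ) - ascCount (k + 1) σ i, ?_⟩, ?_⟩
      left_inv := fun f => ?_
      right_inv := fun g => ?_ }
  · have h1 := (lexMono_iff_strictMono σ f.1).1 f.2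
    have h2 := strictMono_fin_add_le h1 (hlast i)
    have h3 := (f.1 (Fin.last k)).2
    simp only [Fin.val_last] at h2
    omega
  · exact (lexMono_iff_strictMono σ f.1).1 f.2
  · have h1 : StrictMono fun i => (g.1 i : ℕ) := g.2
    have h2 := strictMono_fin_add_le h1 (hlast i)
    have h3 := (g.1 (Fin.last k)).2
    have h4 := ascCount_le_add (k + 1) σ (show (i : ℕ) ≤ k by omega)
    simp only [Fin.val_last] at h2
    have h5 := strictMono_fin_add_le h1 (show 0 ≤ i from Fin.zero_le _)
    have h6 := ascCount_le (k + 1) σ i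
    simp only [Fin.val_zero] at h5
    omega
  · rw [lexMono_iff_strictMono]
    have h1 : StrictMono fun i => (g.1 i : ℕ) := g.2
    convert h1 using 2 with i
    have h5 := strictMono_fin_add_le h1 (show 0 ≤ i from Fin.zero_le _)
    have h6 := ascCount_le (k + 1) σ i
    simp only [Fin.val_zero] at h5
    simp only
    omega
  · apply Subtype.ext
    funext i
    simp
  · apply Subtype.ext
    funext i
    have h1 : StrictMono fun i => (g.1 i : ℕ) := g.2
    have h5 := strictMono_fin_add_le h1 (show 0 ≤ i from Fin.zero_le _)
    have h6 := ascCount_le (k + 1) σ i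
    simp only [Fin.val_zero] at h5
    ext
    simp only
    omega

theorem Qs_eq_card {n : ℕ} (hn : 1 ≤ n) (m : ℕ) (σ : Equiv.Perm (Fin n)) :
    Qs n m σ = ((m : ℝ) ^ n)⁻¹ * (Nat.card (Fillings n (Fin m) σ) : ℝ) := by
  rw [card_fillings_fin hn, Qs]

theorem Qs_nonneg (n m : ℕ) (σ : Equiv.Perm (Fin n)) : 0 ≤ Qs n m σ := by
  unfold Qs; positivity

theorem sum_Qs {n : ℕ} (hn : 1 ≤ n) {m : ℕ} (hm : m ≠ 0) :
    ∑ σ : Equiv.Perm (Fin n), Qs n m σ = 1 := by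
  simp_rw [Qs_eq_card hn]
  rw [← Finset.mul_sum]
  have := sum_card_fillings n (Fin m)
  have h : (∑ σ : Equiv.Perm (Fin n), (Nat.card (Fillings n (Fin m) σ) : ℝ)) = (m : ℝ) ^ n := by
    rw [← Nat.cast_sum, this]
    simp
  rw [h, inv_mul_cancel₀ (by positivity)]

theorem Qs_zero {n : ℕ} (hn : 1 ≤ n) (σ : Equiv.Perm (Fin n)) : Qs n 0 σ = 0 := by
  unfold Qs
  simp [show n ≠ 0 by omega]

theorem Qs_le_one {n : ℕ} (hn : 1 ≤ n) (m : ℕ) (σ : Equiv.Perm (Fin n)) : Qs n m σ ≤ 1 := by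
  rcases eq_or_ne m 0 with rfl | hm
  · rw [Qs_zero hn]; exact zero_le_one
  · rw [← sum_Qs hn hm]
    exact Finset.single_le_sum (fun τ _ => Qs_nonneg n m τ) (Finset.mem_univ σ)

/-- An `a`-shuffle followed by a `b`-shuffle is an `ab`-shuffle. -/
theorem convol_Qs {n : ℕ} (hn : 1 ≤ n) (a b : ℕ) (σ : Equiv.Perm (Fin n)) :
    ∑ τ : Equiv.Perm (Fin n), Qs n a (σ * τ⁻¹) * Qs n b τ = Qs n (a * b) σ := by
  have e : (Fin a ×ₗ Fin b) ≃o Fin (a * b) :=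
    (Fintype.orderIsoFinOfCardEq (Fin a ×ₗ Fin b) (by simp [Lex])).symm
  simp_rw [Qs_eq_card hn]
  rw [← card_fillings_congr n e, card_fillings_prod]
  push_cast
  rw [Finset.mul_sum]
  refine Finset.sum_congr rfl fun τ _ => ?_
  rw [mul_pow, mul_inv]
  ring

/-- `1` at a descent of `σ⁻¹` and `-1` at an ascent. -/
def descSign (n : ℕ) (i : ℕ) (σ : Equiv.Perm (Fin n)) : ℝ :=
  if invAt n σ (i + 1) < invAt n σ i then 1 else -1

/-- Twice the deviation of the number of rising sequences from its uniform mean. -/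
def rDev (n : ℕ) (σ : Equiv.Perm (Fin n)) : ℝ := 2 * rSeq n σ - (n + 1)

theorem rDev_eq_sum {n : ℕ} (hn : 1 ≤ n) (σ : Equiv.Perm (Fin n)) :
    rDev n σ = ∑ i ∈ Finset.range (n - 1), descSign n i σ := by
  have h : ∀ i, descSign n i σ = 2 * (if invAt n σ (i + 1) < invAt n σ i then 1 else 0) - 1 := by
    intro i
    unfold descSign
    split_ifs <;> norm_num
  simp_rw [h]
  rw [Finset.sum_sub_distrib, ← Finset.mul_sum, Finset.sum_boole]
  unfold rDev rSeq
  push_cast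
  simp only [Finset.sum_const, Finset.card_range, nsmul_eq_mul, mul_one, Nat.cast_sub hn]
  push_cast
  ring

theorem invAt_lt_iff {n : ℕ} (σ : Equiv.Perm (Fin n)) {i j : ℕ} (hi : i < n) (hj : j < n) :
    invAt n σ i < invAt n σ j ↔ σ⁻¹ ⟨i, hi⟩ < σ⁻¹ ⟨j, hj⟩ := by
  unfold invAt
  rw [dif_pos hi, dif_pos hj, Fin.lt_def]

theorem descSign_swap_self {n i : ℕ} (hi : i + 1 < n) (σ : Equiv.Perm (Fin n)) :
    descSign n i (Equiv.swap ⟨i, by omega⟩ ⟨i + 1, hi⟩ * σ) = - descSign n i σ := by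
  unfold descSign
  simp only [invAt_lt_iff _ hi (show i < n by omega), mul_inv_rev, Equiv.swap_inv,
    Equiv.Perm.mul_apply, Equiv.swap_apply_left, Equiv.swap_apply_right]
  have h5 : σ⁻¹ ⟨i, by omega⟩ ≠ σ⁻¹ ⟨i + 1, hi⟩ := by
    simp [Fin.ext_iff]
  rcases lt_or_gt_of_ne h5 with h | h
  · rw [if_pos h, if_neg h.asymm]; norm_num
  · rw [if_pos h, if_neg h.asymm]

theorem descSign_swap_of_ne {n i j : ℕ} (hi : i + 1 < n) (hj : j + 1 < n)
    (hij : i + 1 < j ∨ j + 1 < i) (σ : Equiv.Perm (Fin n)) :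
    descSign n j (Equiv.swap ⟨i, by omega⟩ ⟨i + 1, hi⟩ * σ) = descSign n j σ := by
  unfold descSign
  simp only [invAt_lt_iff _ hj (show j < n by omega), mul_inv_rev, Equiv.swap_inv,
    Equiv.Perm.mul_apply]
  rw [Equiv.swap_apply_of_ne_of_ne, Equiv.swap_apply_of_ne_of_ne] <;>
    simp only [ne_eq, Fin.mk.injEq] <;> omega

theorem sum_descSign_mul {n i j : ℕ} (hi : i + 1 < n) (hj : j + 1 < n)
    (hij : i + 1 < j ∨ j + 1 < i) :
    ∑ σ : Equiv.Perm (Fin n), descSign n i σ * descSign n j σ = 0 := by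
  have h := Equiv.sum_comp (Equiv.mulLeft (Equiv.swap (⟨i, by omega⟩ : Fin n) ⟨i + 1, hi⟩))
    (fun σ => descSign n i σ * descSign n j σ)
  simp only [Equiv.coe_mulLeft, descSign_swap_self hi, descSign_swap_of_ne hi hj hij] at h
  simp only [neg_mul, Finset.sum_neg_distrib] at h
  linarith

theorem sum_descSign_mul_le {n : ℕ} (i j : ℕ) :
    ∑ σ : Equiv.Perm (Fin n), descSign n i σ * descSign n j σ ≤ n.factorial := by
  have : ∀ σ : Equiv.Perm (Fin n), descSign n i σ * descSign n j σ ≤ 1 := by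
    intro σ
    unfold descSign
    split_ifs <;> norm_num
  refine (Finset.sum_le_sum fun σ _ => this σ).trans ?_
  simp [Fintype.card_perm]

theorem sum_rDev_sq_le {n : ℕ} (hn : 1 ≤ n) :
    ∑ σ : Equiv.Perm (Fin n), rDev n σ ^ 2 ≤ 3 * n * n.factorial := by
  simp_rw [rDev_eq_sum hn, sq, Finset.sum_mul_sum]
  rw [Finset.sum_comm]
  have h1 : ∀ i ∈ Finset.range (n - 1), ∑ σ : Equiv.Perm (Fin n),
      ∑ j ∈ Finset.range (n - 1), descSign n i σ * descSign n j σ ≤ 3 * n.factorial := by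
    intro i hi
    rw [Finset.sum_comm]
    have h2 : ∑ j ∈ Finset.range (n - 1), ∑ σ : Equiv.Perm (Fin n),
        descSign n i σ * descSign n j σ ≤
        ∑ j ∈ Finset.range (n - 1), if j ∈ ({i - 1, i, i + 1} : Finset ℕ) then
          (n.factorial : ℝ) else 0 := by
      refine Finset.sum_le_sum fun j hj => ?_
      simp only [Finset.mem_range] at hi hj
      split_ifs with h
      · exact sum_descSign_mul_le i j
      · simp only [Finset.mem_insert, Finset.mem_singleton, not_or] at h
        exact (sum_descSign_mul (by omega) (by omega) (by omega)).le
    refine h2.trans ?_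
    rw [← Finset.sum_filter, Finset.sum_const, nsmul_eq_mul]
    gcongr
    have h3 : ((Finset.range (n - 1)).filter fun j => j ∈ ({i - 1, i, i + 1} : Finset ℕ)).card
        ≤ ({i - 1, i, i + 1} : Finset ℕ).card := by
      apply Finset.card_le_card
      intro j hj
      exact (Finset.mem_filter.1 hj).2
    exact_mod_cast h3.trans Finset.card_le_three
  refine (Finset.sum_le_sum h1).trans ?_
  rw [Finset.sum_const, nsmul_eq_mul, Finset.card_range]
  have : ((n - 1 : ℕ) : ℝ) ≤ n := by exact_mod_cast Nat.sub_le n 1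
  have h4 : (0 : ℝ) ≤ n.factorial := by positivity
  nlinarith

theorem sum_abs_rDev_le {n : ℕ} (hn : 1 ≤ n) :
    ∑ σ : Equiv.Perm (Fin n), |rDev n σ| ≤ 2 * Real.sqrt n * n.factorial := by
  have hs : 0 < Real.sqrt n := Real.sqrt_pos.2 (by exact_mod_cast hn)
  have hs2 : Real.sqrt n ^ 2 = n := Real.sq_sqrt (by positivity)
  have h : ∀ σ : Equiv.Perm (Fin n),
      |rDev n σ| ≤ Real.sqrt n + rDev n σ ^ 2 / (4 * Real.sqrt n) := by
    intro σ
    rw [← sq_abs, ← sub_nonneg]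
    have : Real.sqrt n + |rDev n σ| ^ 2 / (4 * Real.sqrt n) - |rDev n σ| =
      (2 * Real.sqrt n - |rDev n σ|) ^ 2 / (4 * Real.sqrt n) := by
      field_simp; ring
    rw [this]; positivity
  refine (Finset.sum_le_sum fun σ _ => h σ).trans ?_
  rw [Finset.sum_add_distrib, ← Finset.sum_div, Finset.sum_const, nsmul_eq_mul]
  have h2 := sum_rDev_sq_le hn
  have h3 : (∑ σ : Equiv.Perm (Fin n), rDev n σ ^ 2) / (4 * Real.sqrt n) ≤
      Real.sqrt n * n.factorial := by
    rw [div_le_iff₀ (by positivity)]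
    have : (0 : ℝ) ≤ n * n.factorial := by positivity
    have e : Real.sqrt n * n.factorial * (4 * Real.sqrt n) = 4 * (n * n.factorial) := by
      nth_rewrite 3 [← hs2]; ring
    rw [e]
    linarith
  have h4 : ((Finset.univ : Finset (Equiv.Perm (Fin n))).card : ℝ) = n.factorial := by
    simp [Fintype.card_perm]
  rw [h4]
  linarith

theorem card_rDev_ge_le {n : ℕ} (hn : 1 ≤ n) {a : ℝ} (ha : 0 < a) :
    ((Finset.univ.filter fun σ : Equiv.Perm (Fin n) => a ≤ |rDev n σ|).card : ℝ) ≤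
      3 * n / a ^ 2 * n.factorial := by
  have h1 : ((Finset.univ.filter fun σ : Equiv.Perm (Fin n) => a ≤ |rDev n σ|).card : ℝ) * a ^ 2
      ≤ ∑ σ : Equiv.Perm (Fin n), rDev n σ ^ 2 := by
    rw [← nsmul_eq_mul]
    refine (Finset.card_nsmul_le_sum _ (fun σ => rDev n σ ^ 2) _ ?_).trans
      (Finset.sum_le_sum_of_subset_of_nonneg (Finset.subset_univ _) fun _ _ _ => sq_nonneg _)
    intro σ hσ
    rw [← sq_abs (rDev n σ)]
    exact pow_le_pow_left₀ ha.le (Finset.mem_filter.1 hσ).2 2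
  have h2 := h1.trans (sum_rDev_sq_le hn)
  rw [div_mul_eq_mul_div, le_div_iff₀ (by positivity)]
  exact h2

theorem rDev_mul_rev {n : ℕ} (hn : 1 ≤ n) (σ : Equiv.Perm (Fin n)) :
    rDev n (σ * Fin.revPerm) = - rDev n σ := by
  rw [rDev_eq_sum hn, rDev_eq_sum hn, ← Finset.sum_neg_distrib]
  refine Finset.sum_congr rfl fun i hi => ?_
  have hi : i + 1 < n := by have := Finset.mem_range.1 hi; omega
  unfold descSign
  simp only [invAt_lt_iff _ hi (show i < n by omega)]
  have h5 : σ⁻¹ ⟨i, by omega⟩ ≠ σ⁻¹ ⟨i + 1, hi⟩ := by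
    simp [Fin.ext_iff]
  have h6 : ∀ x : Fin n, (σ * Fin.revPerm : Equiv.Perm (Fin n))⁻¹ x = Fin.rev (σ⁻¹ x) := by
    intro x
    rw [mul_inv_rev, Equiv.Perm.mul_apply]
    rfl
  simp only [h6, Fin.rev_lt_rev]
  rcases lt_or_gt_of_ne h5 with h | h
  · rw [if_pos h, if_neg h.asymm]; norm_num
  · rw [if_pos h, if_neg h.asymm]

theorem half_le_card_rDev_nonneg {n : ℕ} (hn : 1 ≤ n) :
    (n.factorial : ℝ) / 2 ≤
      ((Finset.univ.filter fun σ : Equiv.Perm (Fin n) => 0 ≤ rDev n σ).card : ℝ) := by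
  have h1 : (Finset.univ.filter fun σ : Equiv.Perm (Fin n) => ¬ 0 ≤ rDev n σ).card ≤
      (Finset.univ.filter fun σ : Equiv.Perm (Fin n) => 0 ≤ rDev n σ).card := by
    refine Finset.card_le_card_of_injOn (fun σ => σ * Fin.revPerm) ?_ ?_
    · intro σ hσ
      simp only [Finset.coe_filter, Finset.mem_univ, true_and, Set.mem_ofPred_eq, not_le,
        rDev_mul_rev hn] at hσ ⊢
      linarith
    · exact fun a _ b _ h => mul_right_cancel h
  have h2 := Finset.card_filter_add_card_filter_not
    (s := (Finset.univ : Finset (Equiv.Perm (Fin n)))) (fun σ => 0 ≤ rDev n σ)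
  rw [Finset.card_univ, Fintype.card_perm, Fintype.card_fin] at h2
  have h3 : (n.factorial : ℝ) =
    ((Finset.univ.filter fun σ : Equiv.Perm (Fin n) => 0 ≤ rDev n σ).card : ℝ) +
    ((Finset.univ.filter fun σ : Equiv.Perm (Fin n) => ¬ 0 ≤ rDev n σ).card : ℝ) := by
    exact_mod_cast h2.symm
  have h4 : ((Finset.univ.filter fun σ : Equiv.Perm (Fin n) => ¬ 0 ≤ rDev n σ).card : ℝ) ≤
    ((Finset.univ.filter fun σ : Equiv.Perm (Fin n) => 0 ≤ rDev n σ).card : ℝ) := by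
    exact_mod_cast h1
  linarith

theorem one_add_le_exp_sub_sq {u : ℝ} (h1 : -1 < u) (h2 : u ≤ 3) :
    1 + u ≤ Real.exp (u - u ^ 2 / 9) := by
  have hpos : 0 < 1 + u := by linarith
  rw [← Real.log_le_iff_le_exp hpos]
  set w := Real.sqrt (1 + u) with hw
  have hw0 : 0 < w := Real.sqrt_pos.2 hpos
  have hw2 : w ^ 2 = 1 + u := Real.sq_sqrt hpos.le
  have hwle : w ≤ 2 := by nlinarith
  have hlog : Real.log (1 + u) = 2 * Real.log w := by
    rw [← hw2, Real.log_pow]; norm_num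
  have h3 := Real.log_le_sub_one_of_pos hw0
  have hu : u = w ^ 2 - 1 := by linarith
  rw [hlog, hu]
  have h4 : (w + 1) ^ 2 ≤ 9 := by nlinarith
  have h5 : (w ^ 2 - 1) ^ 2 / 9 ≤ (w - 1) ^ 2 := by
    have : (w ^ 2 - 1) ^ 2 = (w - 1) ^ 2 * (w + 1) ^ 2 := by ring
    rw [this]
    nlinarith [sq_nonneg (w - 1)]
  nlinarith

theorem exp_sub_sq_le_one_add {u : ℝ} (h1 : |u| ≤ 1 / 2) :
    Real.exp (u - 2 * u ^ 2) ≤ 1 + u := by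
  have h := abs_le.1 h1
  have hpos : 0 < 1 + u := by linarith
  rw [← Real.le_log_iff_exp_le hpos]
  refine le_trans ?_ (Real.one_sub_inv_le_log_of_pos hpos)
  have : 1 - (1 + u)⁻¹ - (u - 2 * u ^ 2) = u ^ 2 * (1 + 2 * u) / (1 + u) := by
    field_simp; ring
  have h3 : 0 ≤ u ^ 2 * (1 + 2 * u) / (1 + u) := by
    apply div_nonneg (mul_nonneg (sq_nonneg _) (by linarith)) hpos.le
  linarith

theorem factorial_mul_Qs {n m : ℕ} (hn : 1 ≤ n) (hm : m ≠ 0) (σ : Equiv.Perm (Fin n))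
    (hr : rSeq n σ ≤ m) :
    (n.factorial : ℝ) * Qs n m σ =
      ∏ i ∈ Finset.range n, (1 + ((n : ℝ) - i - rSeq n σ) / m) := by
  have hm' : (m : ℝ) ≠ 0 := by exact_mod_cast hm
  have h1 : (n.factorial : ℝ) * (Nat.choose (n + m - rSeq n σ) n : ℝ) =
      ∏ i ∈ Finset.range n, ((n : ℝ) + m - rSeq n σ - i) := by
    rw [← Nat.cast_mul, ← Nat.descFactorial_eq_factorial_mul_choose,
      Nat.descFactorial_eq_prod_range, Nat.cast_prod]
    refine Finset.prod_congr rfl fun i hi => ?_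
    have := Finset.mem_range.1 hi
    rw [Nat.cast_sub (by omega), Nat.cast_sub (by omega)]
    push_cast
    ring
  unfold Qs
  rw [mul_left_comm, h1]
  have h2 : ((m : ℝ) ^ n)⁻¹ = ∏ _i ∈ Finset.range n, (m : ℝ)⁻¹ := by simp
  rw [h2, ← Finset.prod_mul_distrib]
  refine Finset.prod_congr rfl fun i _ => ?_
  field_simp
  ring

theorem sum_range_sub (n : ℕ) (x : ℝ) :
    ∑ i ∈ Finset.range n, ((i : ℝ) - x) = n * (n - 1) / 2 - n * x := by
  induction n with
  | zero => simp
  | succ k ih => rw [Finset.sum_range_succ, ih]; push_cast; ring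

theorem sum_range_sub_sq (n : ℕ) (x : ℝ) :
    ∑ i ∈ Finset.range n, ((i : ℝ) - x) ^ 2 =
      n * ((n : ℝ) ^ 2 - 1) / 12 + n * (x - (n - 1) / 2) ^ 2 := by
  induction n with
  | zero => simp
  | succ k ih => rw [Finset.sum_range_succ, ih]; push_cast; ring

theorem sum_ratio (n m : ℕ) (σ : Equiv.Perm (Fin n)) :
    ∑ i ∈ Finset.range n, ((n : ℝ) - i - rSeq n σ) / m = - (n * rDev n σ / (2 * m)) := by
  have : ∀ i : ℕ, ((n : ℝ) - i - rSeq n σ) / m = - ((i : ℝ) - (n - rSeq n σ)) / m := by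
    intro i; ring
  simp_rw [this, ← Finset.sum_div, Finset.sum_neg_distrib, sum_range_sub]
  unfold rDev
  rcases eq_or_ne (m : ℝ) 0 with h | h
  · simp [h]
  · field_simp; ring

theorem sum_ratio_sq (n m : ℕ) (σ : Equiv.Perm (Fin n)) (hn : 2 ≤ n) :
    (n : ℝ) ^ 3 / (16 * m ^ 2) ≤
      ∑ i ∈ Finset.range n, (((n : ℝ) - i - rSeq n σ) / m) ^ 2 := by
  have : ∀ i : ℕ, (((n : ℝ) - i - rSeq n σ) / m) ^ 2 =
      ((i : ℝ) - (n - rSeq n σ)) ^ 2 / m ^ 2 := by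
    intro i; rw [div_pow]; congr 1; ring
  simp_rw [this, ← Finset.sum_div, sum_range_sub_sq]
  rw [← div_div]
  gcongr
  have hn' : (2 : ℝ) ≤ n := by exact_mod_cast hn
  have h1 : 0 ≤ (n : ℝ) * (((n : ℝ) - rSeq n σ) - (n - 1) / 2) ^ 2 := by positivity
  have h2 : (n : ℝ) * 4 ≤ n * n ^ 2 := by gcongr; nlinarith
  nlinarith

/-- The density of an `m`-shuffle with respect to the uniform distribution is small at
permutations with many rising sequences. -/
theorem factorial_mul_Qs_le {n m : ℕ} (hn : 2 ≤ n) (hm : m ≠ 0) (σ : Equiv.Perm (Fin n))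
    (hr : n ≤ 4 * rSeq n σ) :
    (n.factorial : ℝ) * Qs n m σ ≤
      Real.exp (- (n * rDev n σ / (2 * m)) - n ^ 3 / (144 * m ^ 2)) := by
  rcases lt_or_ge m (rSeq n σ) with h | h
  · have : Qs n m σ = 0 := by
      unfold Qs
      rw [Nat.choose_eq_zero_of_lt (by omega)]; simp
    rw [this, mul_zero]
    positivity
  have hm' : (0 : ℝ) < m := by exact_mod_cast Nat.pos_of_ne_zero hm
  rw [factorial_mul_Qs (by omega) hm σ h]
  have hrm : (rSeq n σ : ℝ) ≤ m := by exact_mod_cast h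
  have hr1 : (1 : ℝ) ≤ rSeq n σ := by exact_mod_cast rSeq_pos n σ
  have hnr : (n : ℝ) ≤ 4 * rSeq n σ := by exact_mod_cast hr
  have hi : ∀ i ∈ Finset.range n, -1 < ((n : ℝ) - i - rSeq n σ) / m ∧
      ((n : ℝ) - i - rSeq n σ) / m ≤ 3 := by
    intro i hi
    have hin : (i : ℝ) + 1 ≤ n := by exact_mod_cast Finset.mem_range.1 hi
    have hi0 : (0 : ℝ) ≤ i := by positivity
    rw [lt_div_iff₀ hm', div_le_iff₀ hm']
    constructor <;> linarith
  have h1 : ∏ i ∈ Finset.range n, (1 + ((n : ℝ) - i - rSeq n σ) / m) ≤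
      ∏ i ∈ Finset.range n, Real.exp (((n : ℝ) - i - rSeq n σ) / m -
        (((n : ℝ) - i - rSeq n σ) / m) ^ 2 / 9) := by
    refine Finset.prod_le_prod (fun i h => ?_) fun i h => ?_
    · have := (hi i h).1; linarith
    · exact one_add_le_exp_sub_sq (hi i h).1 (hi i h).2
  refine h1.trans ?_
  rw [← Real.exp_sum, Real.exp_le_exp, Finset.sum_sub_distrib, sum_ratio, ← Finset.sum_div]
  have := sum_ratio_sq n m σ hn
  have e : (n : ℝ) ^ 3 / (144 * m ^ 2) = (n : ℝ) ^ 3 / (16 * m ^ 2) / 9 := by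
    rw [div_div]; congr 1; ring
  rw [e]
  linarith

theorem le_factorial_mul_Qs {n m : ℕ} (hn : 1 ≤ n) (hm : 2 * n ≤ m) (σ : Equiv.Perm (Fin n)) :
    Real.exp (- (n * rDev n σ / (2 * m)) - 2 * n ^ 3 / m ^ 2) ≤
      (n.factorial : ℝ) * Qs n m σ := by
  have hrn := rSeq_le hn σ
  have hr1 : (1 : ℝ) ≤ rSeq n σ := by exact_mod_cast rSeq_pos n σ
  have hrn' : (rSeq n σ : ℝ) ≤ n := by exact_mod_cast hrn
  have hm' : (0 : ℝ) < m := by exact_mod_cast (show 0 < m by omega)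
  have hmn : 2 * (n : ℝ) ≤ m := by exact_mod_cast hm
  rw [factorial_mul_Qs hn (by omega) σ (by omega)]
  have hi : ∀ i ∈ Finset.range n, |((n : ℝ) - i - rSeq n σ) / m| ≤ n / m := by
    intro i hi
    have hin : (i : ℝ) + 1 ≤ n := by exact_mod_cast Finset.mem_range.1 hi
    have hi0 : (0 : ℝ) ≤ i := by positivity
    rw [abs_div, abs_of_pos hm']
    gcongr
    rw [abs_le]
    constructor <;> linarith
  have hnm : (n : ℝ) / m ≤ 1 / 2 := by
    rw [div_le_iff₀ hm']; linarith
  have h1 : ∏ i ∈ Finset.range n, Real.exp (((n : ℝ) - i - rSeq n σ) / m -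
        2 * (((n : ℝ) - i - rSeq n σ) / m) ^ 2) ≤
      ∏ i ∈ Finset.range n, (1 + ((n : ℝ) - i - rSeq n σ) / m) := by
    refine Finset.prod_le_prod (fun i h => (Real.exp_pos _).le) fun i h => ?_
    exact exp_sub_sq_le_one_add ((hi i h).trans hnm)
  refine le_trans ?_ h1
  rw [← Real.exp_sum, Real.exp_le_exp, Finset.sum_sub_distrib, ← Finset.mul_sum, sum_ratio]
  have h2 : ∑ i ∈ Finset.range n, (((n : ℝ) - i - rSeq n σ) / m) ^ 2 ≤ n * (n / m) ^ 2 := by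
    have : ∀ i ∈ Finset.range n, (((n : ℝ) - i - rSeq n σ) / m) ^ 2 ≤ (n / m) ^ 2 := by
      intro i h
      rw [← sq_abs]
      gcongr
      exact hi i h
    refine (Finset.sum_le_sum this).trans ?_
    simp
  have e : 2 * (n : ℝ) ^ 3 / m ^ 2 = 2 * (n * (n / m) ^ 2) := by
    rw [div_pow]; ring
  rw [e]
  linarith

theorem sum_Us (n : ℕ) : ∑ σ, Us n σ = 1 := by
  have : (n.factorial : ℝ) ≠ 0 := by positivity
  simp [Us, Fintype.card_perm, this]

theorem tv_eq_sum_max {n : ℕ} {f g : Equiv.Perm (Fin n) → ℝ} (hf : ∑ σ, f σ = 1)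
    (hg : ∑ σ, g σ = 1) : tv n f g = ∑ σ, max (g σ - f σ) 0 := by
  have h : ∀ σ, max (g σ - f σ) 0 = (1 / 2) * |f σ - g σ| + (1 / 2) * (g σ - f σ) := by
    intro σ
    rcases le_total (f σ) (g σ) with h | h
    · rw [max_eq_left (by linarith), abs_of_nonpos (by linarith)]; ring
    · rw [max_eq_right (by linarith), abs_of_nonneg (by linarith)]; ring
  simp only [h, Finset.sum_add_distrib, ← Finset.mul_sum, Finset.sum_sub_distrib, hf, hg, tv]
  ring

theorem tv_nonneg (n : ℕ) (f g : Equiv.Perm (Fin n) → ℝ) : 0 ≤ tv n f g := by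
  unfold tv; positivity

theorem tv_le_one_sub_sum {n : ℕ} {f g : Equiv.Perm (Fin n) → ℝ} (hf0 : ∀ σ, 0 ≤ f σ)
    (hg0 : ∀ σ, 0 ≤ g σ) (hf : ∑ σ, f σ = 1)
    (hg : ∑ σ, g σ = 1) (A : Finset (Equiv.Perm (Fin n))) {k : Equiv.Perm (Fin n) → ℝ}
    (hkf : ∀ σ ∈ A, k σ ≤ f σ) (hkg : ∀ σ ∈ A, k σ ≤ g σ) :
    tv n f g ≤ 1 - ∑ σ ∈ A, k σ := by
  rw [tv_eq_sum_max hf hg, le_sub_iff_add_le, ← hg,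
    ← Finset.sum_filter_add_sum_filter_not Finset.univ (· ∈ A) (fun σ => max (g σ - f σ) 0),
    ← Finset.sum_filter_add_sum_filter_not Finset.univ (· ∈ A) g]
  simp only [Finset.filter_mem_eq_inter, Finset.univ_inter]
  have h1 : ∑ σ ∈ A, max (g σ - f σ) 0 + ∑ σ ∈ A, k σ ≤ ∑ σ ∈ A, g σ := by
    rw [← Finset.sum_add_distrib]
    refine Finset.sum_le_sum fun σ h => ?_
    have := hkf σ h
    have := hkg σ h
    rcases max_cases (g σ - f σ) 0 with h | h <;> linarith
  have h2 : ∑ σ with σ ∉ A, max (g σ - f σ) 0 ≤ ∑ σ with σ ∉ A, g σ := by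
    refine Finset.sum_le_sum fun σ h => ?_
    exact max_le (by linarith [hf0 σ]) (hg0 σ)
  linarith

theorem tv_le_one {n : ℕ} {f g : Equiv.Perm (Fin n) → ℝ} (hf0 : ∀ σ, 0 ≤ f σ)
    (hg0 : ∀ σ, 0 ≤ g σ) (hf : ∑ σ, f σ = 1) (hg : ∑ σ, g σ = 1) : tv n f g ≤ 1 := by
  simpa using tv_le_one_sub_sum hf0 hg0 hf hg ∅ (k := fun _ => 0) (by simp) (by simp)

theorem sum_sub_sum_le_tv {n : ℕ} {f g : Equiv.Perm (Fin n) → ℝ} (hf : ∑ σ, f σ = 1)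
    (hg : ∑ σ, g σ = 1) (A : Finset (Equiv.Perm (Fin n))) :
    ∑ σ ∈ A, g σ - ∑ σ ∈ A, f σ ≤ tv n f g := by
  rw [tv_eq_sum_max hf hg, ← Finset.sum_sub_distrib]
  calc _ ≤ ∑ σ ∈ A, max (g σ - f σ) 0 := Finset.sum_le_sum fun _ _ => le_max_left _ _
    _ ≤ _ := Finset.sum_le_sum_of_subset_of_nonneg (Finset.subset_univ _)
      fun _ _ _ => le_max_right _ _

theorem Us_nonneg (n : ℕ) (σ : Equiv.Perm (Fin n)) : 0 ≤ Us n σ := by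
  unfold Us; positivity

theorem sum_Us_finset (n : ℕ) (A : Finset (Equiv.Perm (Fin n))) :
    ∑ σ ∈ A, Us n σ = A.card * (n.factorial : ℝ)⁻¹ := by
  simp [Us]

/-- The mixture of the `m`-shuffle distributions with random `m` of law `ν`. -/
def mixQs (n : ℕ) (ν : Measure ℕ) (σ : Equiv.Perm (Fin n)) : ℝ := ∫ m, Qs n m σ ∂ν

theorem mixQs_nonneg {n : ℕ} (ν : Measure ℕ) (σ : Equiv.Perm (Fin n)) : 0 ≤ mixQs n ν σ :=
  integral_nonneg fun m => Qs_nonneg n m σ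

section Mixture

variable {n : ℕ} (ν : Measure ℕ) [IsProbabilityMeasure ν]

theorem integrable_of_bounded (f : ℕ → ℝ) (C : ℝ) (hf : ∀ m, |f m| ≤ C) : Integrable f ν :=
  Integrable.of_bound (by fun_prop) C (Eventually.of_forall fun m => by simpa using hf m)

theorem integrable_Qs (hn : 1 ≤ n) (σ : Equiv.Perm (Fin n)) :
    Integrable (fun m => Qs n m σ) ν :=
  integrable_of_bounded ν _ 1 fun m => by
    rw [abs_of_nonneg (Qs_nonneg n m σ)]; exact Qs_le_one hn m σ

theorem ae_ne_zero {ν : Measure ℕ} (h0 : ν {0} = 0) : ∀ᵐ m ∂ν, m ≠ 0 := by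
  rw [ae_iff]; simpa using h0

theorem sum_mixQs (hn : 1 ≤ n) (h0 : ν {0} = 0) : ∑ σ, mixQs n ν σ = 1 := by
  unfold mixQs
  rw [← integral_finsetSum _ fun σ _ => integrable_Qs ν hn σ]
  rw [integral_congr_ae (g := fun _ => (1 : ℝ))]
  · simp
  · filter_upwards [ae_ne_zero h0] with m hm
    exact sum_Qs hn hm

theorem tv_mixQs_mem (hn : 1 ≤ n) (h0 : ν {0} = 0) :
    tv n (mixQs n ν) (Us n) ∈ Set.Icc (0 : ℝ) 1 :=
  ⟨tv_nonneg _ _ _, tv_le_one (mixQs_nonneg ν) (Us_nonneg n) (sum_mixQs ν hn h0) (sum_Us n)⟩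

theorem tv_mixQs_le (hn : 1 ≤ n) (h0 : ν {0} = 0) (B : Set ℕ) {a b : ℝ}
    (hB : ∀ m ∈ B, m ≠ 0 → tv n (Qs n m) (Us n) ≤ a)
    (hB' : ∀ m ∉ B, m ≠ 0 → tv n (Qs n m) (Us n) ≤ b) :
    tv n (mixQs n ν) (Us n) ≤ a * ν.real B + b * ν.real Bᶜ := by
  have hinteg : ∀ σ, Integrable (fun m => |Qs n m σ - Us n σ|) ν := fun σ =>
    ((integrable_Qs ν hn σ).sub (integrable_const _)).abs
  have h1 : tv n (mixQs n ν) (Us n) ≤ ∫ m, tv n (Qs n m) (Us n) ∂ν := by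
    unfold tv
    rw [integral_const_mul, integral_finsetSum _ fun σ _ => hinteg σ]
    gcongr with σ
    unfold mixQs
    have : ∫ m, Qs n m σ ∂ν - Us n σ = ∫ m, (Qs n m σ - Us n σ) ∂ν := by
      rw [integral_sub (integrable_Qs ν hn σ) (integrable_const _)]; simp
    rw [this]
    exact abs_integral_le_integral_abs
  refine h1.trans ?_
  have h2 : ∫ m, tv n (Qs n m) (Us n) ∂ν ≤
      ∫ m, (B.indicator (fun _ => a) m + Bᶜ.indicator (fun _ => b) m) ∂ν := by
    refine integral_mono_ae ?_ ?_ ?_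
    · exact (integrable_finsetSum _ fun σ _ => hinteg σ).const_mul _
    · exact ((integrable_const a).indicator .of_discrete).add
        ((integrable_const b).indicator .of_discrete)
    · filter_upwards [ae_ne_zero h0] with m hm
      by_cases h : m ∈ B
      · simpa [h] using hB m h hm
      · simpa [h] using hB' m h hm
  refine h2.trans (le_of_eq ?_)
  rw [integral_add ((integrable_const a).indicator .of_discrete)
        ((integrable_const b).indicator .of_discrete), integral_indicator .of_discrete,
        integral_indicator .of_discrete]
  simp [mul_comm]

theorem le_tv_mixQs (hn : 1 ≤ n) (h0 : ν {0} = 0) (A : Finset (Equiv.Perm (Fin n)))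
    (B : Set ℕ) {a b : ℝ}
    (hB : ∀ m ∈ B, m ≠ 0 → a ≤ A.card * (n.factorial : ℝ)⁻¹ - ∑ σ ∈ A, Qs n m σ)
    (hB' : ∀ m ∉ B, m ≠ 0 → b ≤ A.card * (n.factorial : ℝ)⁻¹ - ∑ σ ∈ A, Qs n m σ) :
    a * ν.real B + b * ν.real Bᶜ ≤ tv n (mixQs n ν) (Us n) := by
  refine le_trans ?_ (sum_sub_sum_le_tv (sum_mixQs ν hn h0) (sum_Us n) A)
  rw [sum_Us_finset]
  unfold mixQs
  rw [← integral_finsetSum _ fun σ _ => integrable_Qs ν hn σ]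
  have hi : Integrable (fun m => ∑ σ ∈ A, Qs n m σ) ν :=
    integrable_finsetSum _ fun σ _ => integrable_Qs ν hn σ
  have : A.card * (n.factorial : ℝ)⁻¹ - ∫ m, ∑ σ ∈ A, Qs n m σ ∂ν =
      ∫ m, (A.card * (n.factorial : ℝ)⁻¹ - ∑ σ ∈ A, Qs n m σ) ∂ν := by
    rw [integral_sub (integrable_const _) hi]; simp
  rw [this]
  have h2 : ∫ m, (B.indicator (fun _ => a) m + Bᶜ.indicator (fun _ => b) m) ∂ν ≤
      ∫ m, (A.card * (n.factorial : ℝ)⁻¹ - ∑ σ ∈ A, Qs n m σ) ∂ν := by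
    refine integral_mono_ae ?_ ?_ ?_
    · exact ((integrable_const a).indicator .of_discrete).add
        ((integrable_const b).indicator .of_discrete)
    · exact (integrable_const _).sub hi
    · filter_upwards [ae_ne_zero h0] with m hm
      by_cases h : m ∈ B
      · simpa [h] using hB m h hm
      · simpa [h] using hB' m h hm
  refine le_trans (le_of_eq ?_) h2
  rw [integral_add ((integrable_const a).indicator .of_discrete)
        ((integrable_const b).indicator .of_discrete), integral_indicator .of_discrete,
        integral_indicator .of_discrete]
  simp [mul_comm]

end Mixture

theorem cube_eq_mul_sqrt_sq (n : ℕ) : (n : ℝ) ^ 3 = (n * Real.sqrt n) ^ 2 := by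
  rw [mul_pow, Real.sq_sqrt (by positivity)]; ring

theorem exp_three_halves_log {n : ℕ} (hn : 1 ≤ n) (x : ℝ) :
    Real.exp (3 / 2 * Real.log n + x) = n * Real.sqrt n * Real.exp x := by
  have h : (0 : ℝ) < n := by exact_mod_cast hn
  have : 3 / 2 * Real.log n = Real.log n + Real.log n / 2 := by ring
  rw [Real.exp_add, this, Real.exp_add, Real.exp_log h, Real.sqrt_eq_rpow,
    Real.rpow_def_of_pos h]
  congr 3; ring

theorem tv_Qs_le {n m : ℕ} (hn : 1 ≤ n) (hm : 2 * n ≤ m) :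
    tv n (Qs n m) (Us n) ≤ n * Real.sqrt n / m + 2 * (n * Real.sqrt n / m) ^ 2 := by
  have hm0 : m ≠ 0 := by omega
  have hmp : (0 : ℝ) < m := by exact_mod_cast Nat.pos_of_ne_zero hm0
  have hf : (0 : ℝ) < n.factorial := by positivity
  rw [tv_eq_sum_max (sum_Qs hn hm0) (sum_Us n)]
  have h : ∀ σ : Equiv.Perm (Fin n), max (Us n σ - Qs n m σ) 0 ≤
      (n.factorial : ℝ)⁻¹ * (n / (2 * m) * |rDev n σ| + 2 * (n * Real.sqrt n / m) ^ 2) := by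
    intro σ
    have h1 := le_factorial_mul_Qs hn hm σ
    have h2 := Real.add_one_le_exp (- (n * rDev n σ / (2 * m)) - 2 * (n : ℝ) ^ 3 / m ^ 2)
    have h3 : n / (2 * m) * rDev n σ ≤ n / (2 * m) * |rDev n σ| := by
      gcongr; exact le_abs_self _
    refine max_le ?_ (by positivity)
    have h4 : Us n σ - Qs n m σ = (n.factorial : ℝ)⁻¹ * (1 - n.factorial * Qs n m σ) := by
      unfold Us; field_simp
    rw [h4]
    gcongr
    have e1 : n * rDev n σ / (2 * m) = n / (2 * m) * rDev n σ := by ring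
    have e2 : 2 * (n : ℝ) ^ 3 / m ^ 2 = 2 * (n * Real.sqrt n / m) ^ 2 := by
      rw [cube_eq_mul_sqrt_sq]; ring
    linarith
  refine (Finset.sum_le_sum fun σ _ => h σ).trans ?_
  rw [← Finset.mul_sum, Finset.sum_add_distrib, ← Finset.mul_sum]
  simp only [Finset.sum_const, Finset.card_univ, Fintype.card_perm, Fintype.card_fin,
    nsmul_eq_mul]
  rw [inv_mul_le_iff₀ hf]
  have : n / (2 * m) * ∑ σ, |rDev n σ| ≤ n / (2 * m) * (2 * Real.sqrt n * n.factorial) := by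
    gcongr; exact sum_abs_rDev_le hn
  have e : n / (2 * m) * (2 * Real.sqrt n * n.factorial) =
      n.factorial * (n * Real.sqrt n / m) := by field_simp
  linarith

theorem card_rDev_lt_ge {n : ℕ} (hn : 1 ≤ n) {K : ℝ} (hK : 0 < K) :
    1 - 3 / K ^ 2 ≤ ((Finset.univ.filter fun σ : Equiv.Perm (Fin n) =>
      |rDev n σ| < K * Real.sqrt n).card : ℝ) * (n.factorial : ℝ)⁻¹ := by
  have hf : (0 : ℝ) < n.factorial := by positivity
  have hn' : (0 : ℝ) < n := by exact_mod_cast hn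
  have h1 := card_rDev_ge_le hn (a := K * Real.sqrt n) (by positivity)
  have h2 := Finset.card_filter_add_card_filter_not (s := Finset.univ)
    (fun σ : Equiv.Perm (Fin n) => |rDev n σ| < K * Real.sqrt n)
  simp only [not_lt, Finset.card_univ, Fintype.card_perm, Fintype.card_fin] at h2
  have h3 : ((Finset.univ.filter fun σ : Equiv.Perm (Fin n) =>
      |rDev n σ| < K * Real.sqrt n).card : ℝ) = n.factorial - (Finset.univ.filter fun σ :
      Equiv.Perm (Fin n) => K * Real.sqrt n ≤ |rDev n σ|).card := by
    rw [← h2]; push_cast; ring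
  have e : 3 * (n : ℝ) / (K * Real.sqrt n) ^ 2 = 3 / K ^ 2 := by
    rw [mul_pow, Real.sq_sqrt hn'.le]; field_simp
  rw [e] at h1
  rw [h3, ← div_eq_mul_inv, le_div_iff₀ hf]
  linarith

/-- On a set of permutations where the density is at most `δ`, the mass is at most `δ`
times the uniform mass. -/
theorem sum_Qs_le_of_le {n m : ℕ} (A : Finset (Equiv.Perm (Fin n))) {δ : ℝ}
    (h : ∀ σ ∈ A, n.factorial * Qs n m σ ≤ δ) :
    ∑ σ ∈ A, Qs n m σ ≤ δ * (A.card * (n.factorial : ℝ)⁻¹) := by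
  have hf : (0 : ℝ) < n.factorial := by positivity
  have : ∑ σ ∈ A, Qs n m σ ≤ ∑ σ ∈ A, δ * (n.factorial : ℝ)⁻¹ := by
    refine Finset.sum_le_sum fun σ hσ => ?_
    rw [← div_eq_mul_inv, le_div_iff₀ hf, mul_comm]; exact h σ hσ
  refine this.trans (le_of_eq ?_)
  simp; ring

theorem card_mul_inv_le_one {n : ℕ} (A : Finset (Equiv.Perm (Fin n))) :
    (A.card : ℝ) * (n.factorial : ℝ)⁻¹ ≤ 1 := by
  have hf : (0 : ℝ) < n.factorial := by positivity
  rw [← div_eq_mul_inv, div_le_one hf]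
  have := Finset.card_le_univ A
  rw [Fintype.card_perm, Fintype.card_fin] at this
  exact_mod_cast this

theorem log_le_iff_le_exp_nat {m : ℕ} (hm : m ≠ 0) {n : ℕ} (hn : 1 ≤ n) (x : ℝ) :
    Real.log m ≤ 3 / 2 * Real.log n + x ↔ (m : ℝ) ≤ n * Real.sqrt n * Real.exp x := by
  rw [Real.log_le_iff_le_exp (by exact_mod_cast Nat.pos_of_ne_zero hm), exp_three_halves_log hn]

theorem le_log_iff_exp_le_nat {m : ℕ} (hm : m ≠ 0) {n : ℕ} (hn : 1 ≤ n) (x : ℝ) :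
    3 / 2 * Real.log n + x ≤ Real.log m ↔ n * Real.sqrt n * Real.exp x ≤ (m : ℝ) := by
  rw [Real.le_log_iff_exp_le (by exact_mod_cast Nat.pos_of_ne_zero hm), exp_three_halves_log hn]

theorem tv_mixQs_le_of_large {n : ℕ} (ν : Measure ℕ) [IsProbabilityMeasure ν]
    (hn : 4 ≤ n) (h0 : ν {0} = 0) {x : ℝ} (hx : 0 ≤ x) :
    tv n (mixQs n ν) (Us n) ≤
      3 * Real.exp (-x) + ν.real {m : ℕ | Real.log m < 3 / 2 * Real.log n + x} := by
  have hn1 : 1 ≤ n := by omega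
  have hn' : (4 : ℝ) ≤ n := by exact_mod_cast hn
  have h := tv_mixQs_le ν hn1 h0 {m | 3 / 2 * Real.log n + x ≤ Real.log m}
    (a := 3 * Real.exp (-x)) (b := 1) ?_ ?_
  · refine h.trans ?_
    have : ν.real {m | 3 / 2 * Real.log n + x ≤ Real.log m} ≤ 1 := measureReal_le_one
    have e : {m : ℕ | 3 / 2 * Real.log n + x ≤ Real.log m}ᶜ =
      {m : ℕ | Real.log m < 3 / 2 * Real.log n + x} := by ext; simp
    rw [e, one_mul]
    exact add_le_add_left (mul_le_of_le_one_right (by positivity) this) _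
  · intro m hm hm0
    have hmp : (0 : ℝ) < m := by exact_mod_cast Nat.pos_of_ne_zero hm0
    have hm := (le_log_iff_exp_le_nat hm0 hn1 x).1 hm
    have hs : 2 ≤ Real.sqrt n := Real.le_sqrt_of_sq_le (by linarith)
    have hex : 1 ≤ Real.exp x := Real.one_le_exp hx
    have h2n : 2 * n ≤ m := by
      have : 2 * (n : ℝ) ≤ m := by
        refine le_trans ?_ hm
        calc 2 * (n : ℝ) = n * 2 * 1 := by ring
          _ ≤ _ := by gcongr
      exact_mod_cast this
    refine (tv_Qs_le hn1 h2n).trans ?_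
    have hy : n * Real.sqrt n / m ≤ Real.exp (-x) := by
      rw [div_le_iff₀ hmp, Real.exp_neg, inv_mul_eq_div, le_div_iff₀ (Real.exp_pos _)]; exact hm
    have hy0 : 0 ≤ n * Real.sqrt n / m := by positivity
    have : Real.exp (-x) ≤ 1 := by rw [Real.exp_le_one_iff]; linarith
    nlinarith
  · intro m _ hm0
    exact tv_le_one (Qs_nonneg n m) (Us_nonneg n) (sum_Qs hn1 hm0) (sum_Us n)

theorem exists_pos_tv_mixQs_le (C : ℝ) : ∃ η : ℝ, 0 < η ∧ ∃ N : ℕ, ∀ n : ℕ, N ≤ n →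
    ∀ ν : Measure ℕ, IsProbabilityMeasure ν → ν {0} = 0 → tv n (mixQs n ν) (Us n) ≤
      1 - η * ν.real {m | 3 / 2 * Real.log n - C ≤ Real.log m} := by
  set δ : ℝ := Real.exp (-(3 / 2 * Real.exp C) - 2 * Real.exp C ^ 2) with hδ
  have hδ0 : 0 < δ := Real.exp_pos _
  have hδ1 : δ ≤ 1 := Real.exp_le_one_iff.2 (by nlinarith [Real.exp_pos C])
  refine ⟨2 / 3 * δ, by positivity, max 1 ⌈(2 * Real.exp C) ^ 2⌉₊, fun n hn ν _ h0 => ?_⟩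
  have hn1 : 1 ≤ n := le_trans (le_max_left _ _) hn
  have hn2 : (2 * Real.exp C) ^ 2 ≤ n :=
    (Nat.le_ceil _).trans (by exact_mod_cast le_trans (le_max_right _ _) hn)
  have hs : 2 * Real.exp C ≤ Real.sqrt n := Real.le_sqrt_of_sq_le hn2
  have hn' : (0 : ℝ) < n := by exact_mod_cast hn1
  have hf : (0 : ℝ) < n.factorial := by positivity
  have h := tv_mixQs_le ν hn1 h0 {m | 3 / 2 * Real.log n - C ≤ Real.log m}
    (a := 1 - 2 / 3 * δ) (b := 1) ?_ ?_
  · refine h.trans (le_of_eq ?_)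
    rw [probReal_compl_eq_one_sub .of_discrete]
    ring
  · intro m hm hm0
    have hmp : (0 : ℝ) < m := by exact_mod_cast Nat.pos_of_ne_zero hm0
    rw [Set.mem_ofPred_eq, sub_eq_add_neg] at hm
    have hm := (le_log_iff_exp_le_nat hm0 hn1 (-C)).1 hm
    rw [Real.exp_neg, ← div_eq_mul_inv, div_le_iff₀ (Real.exp_pos _)] at hm
    have hy : n * Real.sqrt n / m ≤ Real.exp C := by
      rw [div_le_iff₀ hmp]; linarith
    have h2n : 2 * n ≤ m := by
      have : 2 * (n : ℝ) ≤ m := by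
        have : n * (2 * Real.exp C) ≤ m * Real.exp C := le_trans (by gcongr) hm
        nlinarith [Real.exp_pos C]
      exact_mod_cast this
    set A := Finset.univ.filter fun σ : Equiv.Perm (Fin n) => |rDev n σ| < 3 * Real.sqrt n
    have hA := card_rDev_lt_ge hn1 (K := 3) (by norm_num)
    have h1 := tv_le_one_sub_sum (Qs_nonneg n m) (Us_nonneg n) (sum_Qs hn1 hm0) (sum_Us n) A
      (k := fun _ => δ * (n.factorial : ℝ)⁻¹) ?_ ?_
    · refine h1.trans ?_
      simp only [Finset.sum_const, nsmul_eq_mul]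
      nlinarith
    · intro σ hσ
      rw [Finset.mem_filter_univ] at hσ
      rw [← div_eq_mul_inv, div_le_iff₀ hf, mul_comm]
      refine le_trans ?_ (le_factorial_mul_Qs hn1 h2n σ)
      rw [hδ, Real.exp_le_exp]
      have e2 : 2 * (n : ℝ) ^ 3 / m ^ 2 = 2 * (n * Real.sqrt n / m) ^ 2 := by
        rw [cube_eq_mul_sqrt_sq]; ring
      have e1 : n * rDev n σ / (2 * m) ≤ 3 / 2 * (n * Real.sqrt n / m) := by
        calc n * rDev n σ / (2 * m) ≤ n * (3 * Real.sqrt n) / (2 * m) := by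
              gcongr; exact (le_abs_self _).trans hσ.le
          _ = _ := by ring
      have e3 : (n * Real.sqrt n / m) ^ 2 ≤ Real.exp C ^ 2 := by gcongr
      rw [e2]; linarith
    · intro σ _
      exact mul_le_of_le_one_left (by positivity) hδ1
  · intro m _ hm0
    exact tv_le_one (Qs_nonneg n m) (Us_nonneg n) (sum_Qs hn1 hm0) (sum_Us n)

theorem factorial_mul_Qs_le_exp_sq {n : ℕ} (hn : 2 ≤ n) {m : ℕ} (hm : m ≠ 0)
    (σ : Equiv.Perm (Fin n)) (hr : 0 ≤ rDev n σ) :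
    (n.factorial : ℝ) * Qs n m σ ≤ Real.exp (- ((n * Real.sqrt n / m) ^ 2 / 144)) := by
  have hr4 : n ≤ 4 * rSeq n σ := by
    unfold rDev at hr
    have : (n : ℝ) ≤ 4 * rSeq n σ := by
      have : (0 : ℝ) ≤ n := by positivity
      linarith
    exact_mod_cast this
  refine (factorial_mul_Qs_le hn hm σ hr4).trans (Real.exp_le_exp.2 ?_)
  rw [cube_eq_mul_sqrt_sq]
  have : 0 ≤ n * rDev n σ / (2 * m) := by positivity
  have e : (n * Real.sqrt n / m) ^ 2 / 144 = (n * Real.sqrt n) ^ 2 / (144 * (m : ℝ) ^ 2) := by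
    rw [div_pow, div_div]; ring
  linarith

theorem exists_pos_le_tv_mixQs (C : ℝ) : ∃ η : ℝ, 0 < η ∧ ∀ n : ℕ, 2 ≤ n →
    ∀ ν : Measure ℕ, IsProbabilityMeasure ν → ν {0} = 0 →
      η * ν.real {m : ℕ | Real.log m ≤ 3 / 2 * Real.log n + C} ≤ tv n (mixQs n ν) (Us n) := by
  set δ : ℝ := Real.exp (-(Real.exp (-C) ^ 2 / 144)) with hδ
  have hδ1 : δ < 1 := by
    rw [hδ, Real.exp_lt_one_iff, neg_lt_zero]; positivity
  refine ⟨(1 - δ) / 2, by linarith, fun n hn ν _ h0 => ?_⟩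
  have hn1 : 1 ≤ n := by omega
  have hf : (0 : ℝ) < n.factorial := by positivity
  set A := Finset.univ.filter fun σ : Equiv.Perm (Fin n) => 0 ≤ rDev n σ with hAdef
  have hA : 1 / 2 ≤ (A.card : ℝ) * (n.factorial : ℝ)⁻¹ := by
    rw [← div_eq_mul_inv, le_div_iff₀ hf]
    linarith [half_le_card_rDev_nonneg hn1]
  have h := le_tv_mixQs ν hn1 h0 A {m : ℕ | Real.log m ≤ 3 / 2 * Real.log n + C}
    (a := (1 - δ) / 2) (b := 0) ?_ ?_
  · linarith
  · intro m hm hm0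
    have hmp : (0 : ℝ) < m := by exact_mod_cast Nat.pos_of_ne_zero hm0
    have hm := (log_le_iff_le_exp_nat hm0 hn1 C).1 hm
    have hy : Real.exp (-C) ≤ n * Real.sqrt n / m := by
      rw [le_div_iff₀ hmp, Real.exp_neg, inv_mul_le_iff₀ (Real.exp_pos _)]; linarith
    have := sum_Qs_le_of_le (m := m) A (δ := δ) fun σ hσ => by
      refine (factorial_mul_Qs_le_exp_sq hn hm0 σ (by simpa [hAdef] using hσ)).trans ?_
      rw [hδ]; gcongr
    nlinarith
  · intro m _ hm0
    have := sum_Qs_le_of_le (m := m) A (δ := 1) fun σ hσ => by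
      refine (factorial_mul_Qs_le_exp_sq hn hm0 σ (by simpa [hAdef] using hσ)).trans ?_
      rw [Real.exp_le_one_iff, neg_nonpos]; positivity
    linarith

theorem one_sub_le_tv_mixQs (x : ℝ) : ∃ N : ℕ, ∀ n : ℕ, N ≤ n →
    ∀ ν : Measure ℕ, IsProbabilityMeasure ν → ν {0} = 0 →
      1 - 100000 * Real.exp (-x) ^ 2 - ν.real {m | 3 / 2 * Real.log n - x < Real.log m} ≤
        tv n (mixQs n ν) (Us n) := by
  set K : ℝ := Real.exp x / 144 with hK
  have hK0 : 0 < K := by positivity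
  refine ⟨max 2 ⌈(2 * K) ^ 2⌉₊, fun n hn ν _ h0 => ?_⟩
  have hn2 : 2 ≤ n := le_trans (le_max_left _ _) hn
  have hn1 : 1 ≤ n := by omega
  have hn3 : (2 * K) ^ 2 ≤ n :=
    (Nat.le_ceil _).trans (by exact_mod_cast le_trans (le_max_right _ _) hn)
  have hs : 2 * K ≤ Real.sqrt n := Real.le_sqrt_of_sq_le hn3
  have hf : (0 : ℝ) < n.factorial := by positivity
  have hss : Real.sqrt n * Real.sqrt n = n := Real.mul_self_sqrt (by positivity)
  set A := Finset.univ.filter fun σ : Equiv.Perm (Fin n) => |rDev n σ| < K * Real.sqrt n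
    with hAdef
  have hA := card_rDev_lt_ge hn1 hK0
  have hA1 := card_mul_inv_le_one A
  have he : 3 / K ^ 2 = 62208 * Real.exp (-x) ^ 2 := by
    rw [hK, Real.exp_neg]; field_simp; norm_num
  have h := le_tv_mixQs ν hn1 h0 A {m | 3 / 2 * Real.log n - x < Real.log m}
    (a := - 3 / K ^ 2) (b := 1 - 100000 * Real.exp (-x) ^ 2) ?_ ?_
  · rw [probReal_compl_eq_one_sub .of_discrete] at h
    have h1 : ν.real {m | 3 / 2 * Real.log n - x < Real.log m} ≤ 1 := measureReal_le_one
    have h2 : 0 ≤ ν.real {m | 3 / 2 * Real.log n - x < Real.log m} := measureReal_nonneg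
    have h3 : 0 ≤ Real.exp (-x) ^ 2 := by positivity
    rw [neg_div, he] at h
    nlinarith
  · intro m _ hm0
    have : ∑ σ ∈ A, Qs n m σ ≤ 1 := by
      rw [← sum_Qs hn1 hm0]
      exact Finset.sum_le_sum_of_subset_of_nonneg (Finset.subset_univ _)
        fun σ _ _ => Qs_nonneg n m σ
    rw [neg_div]
    linarith
  · intro m hm hm0
    have hmp : (0 : ℝ) < m := by exact_mod_cast Nat.pos_of_ne_zero hm0
    rw [Set.mem_ofPred_eq, not_lt, sub_eq_add_neg] at hm
    have hm := (log_le_iff_le_exp_nat hm0 hn1 (-x)).1 hm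
    rw [Real.exp_neg, ← div_eq_mul_inv, le_div_iff₀ (Real.exp_pos _)] at hm
    have hy : Real.exp x ≤ n * Real.sqrt n / m := by
      rw [le_div_iff₀ hmp]; linarith
    have hQ := sum_Qs_le_of_le (m := m) A (δ := 288 * Real.exp (-x) ^ 2) fun σ hσ => by
      rw [hAdef, Finset.mem_filter_univ, abs_lt] at hσ
      have hr4 : n ≤ 4 * rSeq n σ := by
        have h1 := hσ.1
        unfold rDev at h1
        have : (n : ℝ) ≤ 4 * rSeq n σ := by nlinarith
        exact_mod_cast this
      refine (factorial_mul_Qs_le hn2 hm0 σ hr4).trans ?_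
      set y : ℝ := n * Real.sqrt n / m with hydef
      have e2 : (n : ℝ) ^ 3 / (144 * m ^ 2) = y ^ 2 / 144 := by
        rw [cube_eq_mul_sqrt_sq, hydef]; ring
      have e1 : -(n * rDev n σ / (2 * m)) ≤ K / 2 * y := by
        calc -(n * rDev n σ / (2 * m)) = n * (-rDev n σ) / (2 * m) := by ring
          _ ≤ n * (K * Real.sqrt n) / (2 * m) := by gcongr; linarith
          _ = _ := by rw [hydef]; ring
      have hex := Real.exp_pos x
      have e3 : -(n * rDev n σ / (2 * m)) - (n : ℝ) ^ 3 / (144 * m ^ 2) ≤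
          -(Real.exp x ^ 2 / 288) := by
        rw [e2]; nlinarith
      refine (Real.exp_le_exp.2 e3).trans ?_
      rw [Real.exp_neg, Real.exp_neg, inv_pow, ← div_eq_mul_inv,
        inv_le_comm₀ (by positivity) (by positivity), inv_div]
      linarith [Real.add_one_le_exp (Real.exp x ^ 2 / 288)]
    have h3 : 0 ≤ Real.exp (-x) ^ 2 := by positivity
    have : 288 * Real.exp (-x) ^ 2 * (A.card * (n.factorial : ℝ)⁻¹) ≤ 288 * Real.exp (-x) ^ 2 :=
      mul_le_of_le_one_right (by positivity) hA1
    linarith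

theorem Qs_one {n : ℕ} (hn : 1 ≤ n) (σ : Equiv.Perm (Fin n)) :
    Qs n 1 σ = if σ = 1 then 1 else 0 := by
  have h1 : Qs n 1 1 = 1 := by
    have : rSeq n 1 = 1 := by
      unfold rSeq
      simp only [Nat.add_eq_left, Finset.card_eq_zero]
      refine Finset.filter_eq_empty_iff.2 fun i hi => ?_
      have hi := Finset.mem_range.1 hi
      unfold invAt
      rw [dif_pos (by omega), dif_pos (by omega)]
      simp
    simp [Qs, this]
  split_ifs with h
  · rw [h, h1]
  · have h2 := sum_Qs hn one_ne_zero
    rw [← Finset.add_sum_erase _ _ (Finset.mem_univ 1), h1, add_eq_left,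
      Finset.sum_eq_zero_iff_of_nonneg fun _ _ => Qs_nonneg _ _ _] at h2
    exact h2 σ (by simp [h])

/-- The weighted sum of the measures `κ k` with nonnegative weights `w k`. -/
def wSum (w : ℕ → ℝ) (κ : ℕ → Measure ℕ) : Measure ℕ :=
  Measure.sum fun k => ENNReal.ofReal (w k) • κ k

section WeightedSum

variable {w : ℕ → ℝ} {κ : ℕ → Measure ℕ}

theorem isProbabilityMeasure_wSum (hw : ∀ k, 0 ≤ w k) (hw1 : HasSum w 1)
    (hκ : ∀ k, IsProbabilityMeasure (κ k)) : IsProbabilityMeasure (wSum w κ) := by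
  constructor
  unfold wSum
  rw [Measure.sum_apply _ .univ]
  simp only [Measure.smul_apply, measure_univ, smul_eq_mul, mul_one]
  rw [← ENNReal.ofReal_tsum_of_nonneg hw hw1.summable, hw1.tsum_eq, ENNReal.ofReal_one]

theorem wSum_singleton_zero (h : ∀ k, w k = 0 ∨ κ k {0} = 0) : wSum w κ {0} = 0 := by
  unfold wSum
  rw [Measure.sum_apply _ (.singleton 0)]
  simp only [Measure.smul_apply, smul_eq_mul, ENNReal.tsum_eq_zero, mul_eq_zero]
  intro k
  rcases h k with h | h <;> simp [h]

theorem hasSum_integral_wSum {E : Type*} [NormedAddCommGroup E] [NormedSpace ℝ E]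
    (hw : ∀ k, 0 ≤ w k) {f : ℕ → E} (hf : Integrable f (wSum w κ)) :
    HasSum (fun k => w k • ∫ m, f m ∂κ k) (∫ m, f m ∂wSum w κ) := by
  have := hasSum_integral_measure hf
  unfold wSum
  simpa [integral_smul_measure, ENNReal.toReal_ofReal (hw _)] using this

end WeightedSum

/-- The probability measure on `ℕ` with point masses `p k`. -/
def pMeas (p : ℕ → ℝ) : Measure ℕ := wSum p Measure.dirac

section PMeas

variable {p : ℕ → ℝ}

theorem hasSum_of_tsum_eq_one (hp : ∑' k, p k = 1) : HasSum p 1 := by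
  rw [← hp]
  refine Summable.hasSum ?_
  by_contra h
  rw [tsum_eq_zero_of_not_summable h] at hp
  exact zero_ne_one hp

theorem isProbabilityMeasure_pMeas (hp0 : ∀ k, 0 ≤ p k) (hp : ∑' k, p k = 1) :
    IsProbabilityMeasure (pMeas p) :=
  isProbabilityMeasure_wSum hp0 (hasSum_of_tsum_eq_one hp) fun _ => inferInstance

theorem pMeas_singleton_zero (hpz : p 0 = 0) : pMeas p {0} = 0 := by
  refine wSum_singleton_zero fun k => ?_
  rcases eq_or_ne k 0 with rfl | hk
  · exact .inl hpz
  · right; simp [hk]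

theorem integrable_pMeas (hp0 : ∀ k, 0 ≤ p k) {f : ℕ → ℝ}
    (hf : Summable fun k => p k * |f k|) : Integrable f (pMeas p) :=
  integrable_sum_dirac (fun _ => ENNReal.ofReal_ne_top) (by
    simpa [ENNReal.toReal_ofReal (hp0 _)] using hf)

theorem integral_pMeas (hp0 : ∀ k, 0 ≤ p k) {f : ℕ → ℝ} (hf : Integrable f (pMeas p)) :
    ∫ m, f m ∂pMeas p = ∑' k, p k * f k := by
  have := (hasSum_integral_wSum hp0 hf).tsum_eq
  unfold pMeas
  simpa using this.symm

end PMeas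

/-- The law of a product of `k` independent variables of law `P`. -/
def mPow (P : Measure ℕ) : ℕ → Measure ℕ
  | 0 => Measure.dirac 1
  | k + 1 => P ∗ₘ mPow P k

instance isProbabilityMeasure_mPow (P : Measure ℕ) [IsProbabilityMeasure P] :
    ∀ k, IsProbabilityMeasure (mPow P k)
  | 0 => by unfold mPow; infer_instance
  | k + 1 => by
    have := isProbabilityMeasure_mPow P k
    unfold mPow; infer_instance

theorem mPow_singleton_zero {P : Measure ℕ} [IsProbabilityMeasure P] (h0 : P {0} = 0) (k : ℕ) :
    mPow P k {0} = 0 := by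
  induction k with
  | zero => simp [mPow]
  | succ k ih =>
    have h : ∀ᵐ z ∂(P.prod (mPow P k)), z.1 * z.2 ≠ 0 := by
      have h1 : ∀ᵐ z ∂(P.prod (mPow P k)), z.1 ≠ 0 :=
        Measure.quasiMeasurePreserving_fst.ae (ae_ne_zero h0)
      have h2 : ∀ᵐ z ∂(P.prod (mPow P k)), z.2 ≠ 0 :=
        Measure.quasiMeasurePreserving_snd.ae (ae_ne_zero ih)
      filter_upwards [h1, h2] with z h1 h2 using mul_ne_zero h1 h2
    unfold mPow Measure.mconv
    rw [Measure.map_apply (by fun_prop) (.singleton 0)]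
    rw [ae_iff] at h
    refine measure_mono_null (fun z hz => ?_) h
    have hz : z.1 = 0 ∨ z.2 = 0 := by simpa using hz
    simpa using hz.resolve_left

theorem iterConv_eq_mixQs {n : ℕ} (hn : 1 ≤ n) {p : ℕ → ℝ} (hp0 : ∀ k, 0 ≤ p k)
    (hp : ∑' k, p k = 1) (k : ℕ) (σ : Equiv.Perm (Fin n)) :
    iterConv n (Qp n p) k σ = mixQs n (mPow (pMeas p) k) σ := by
  have := isProbabilityMeasure_pMeas hp0 hp
  have hQ : ∀ σ, Qp n p σ = ∫ m, Qs n m σ ∂pMeas p := fun σ =>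
    (integral_pMeas hp0 (integrable_Qs _ hn σ)).symm
  induction k generalizing σ with
  | zero => simp [iterConv, mixQs, mPow, Qs_one hn]
  | succ k ih =>
    unfold iterConv convol mixQs mPow
    rw [integral_mconv (integrable_Qs _ hn σ)]
    simp_rw [← convol_Qs hn]
    have hi : ∀ τ : Equiv.Perm (Fin n), ∀ a,
        Integrable (fun y => Qs n a (σ * τ⁻¹) * Qs n y τ) (mPow (pMeas p) k) :=
      fun τ a => (integrable_Qs _ hn τ).const_mul _
    simp_rw [integral_finsetSum _ fun τ _ => hi τ _, integral_const_mul]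
    rw [integral_finsetSum _ fun τ _ => (integrable_Qs _ hn (σ * τ⁻¹)).mul_const _]
    simp_rw [integral_mul_const, ← hQ, ih]
    rfl

/-- The law of a product of a Poisson number of independent variables of law `P`. -/
def cPois (P : Measure ℕ) (t : ℝ) : Measure ℕ :=
  wSum (fun k => Real.exp (-t) * (t ^ k / k.factorial)) (mPow P)

theorem poissonWeight_nonneg {t : ℝ} (ht : 0 ≤ t) (k : ℕ) :
    0 ≤ Real.exp (-t) * (t ^ k / k.factorial) := by positivity

theorem isProbabilityMeasure_cPois (P : Measure ℕ) [IsProbabilityMeasure P] {t : ℝ}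
    (ht : 0 ≤ t) : IsProbabilityMeasure (cPois P t) := by
  refine isProbabilityMeasure_wSum (poissonWeight_nonneg ht) ?_ fun _ => inferInstance
  have := (NormedSpace.expSeries_div_hasSum_exp t).mul_left (Real.exp (-t))
  rwa [← Real.exp_eq_exp_ℝ, ← Real.exp_add, neg_add_cancel, Real.exp_zero] at this

theorem cPois_singleton_zero {P : Measure ℕ} [IsProbabilityMeasure P] (h0 : P {0} = 0) (t : ℝ) :
    cPois P t {0} = 0 :=
  wSum_singleton_zero fun k => .inr (mPow_singleton_zero h0 k)

theorem Hp_eq_mixQs {n : ℕ} (hn : 1 ≤ n) {p : ℕ → ℝ} (hp0 : ∀ k, 0 ≤ p k)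
    (hp : ∑' k, p k = 1) {t : ℝ} (ht : 0 ≤ t) :
    Hp n p t = mixQs n (cPois (pMeas p) t) := by
  have := isProbabilityMeasure_pMeas hp0 hp
  have := isProbabilityMeasure_cPois (pMeas p) ht
  ext σ
  unfold Hp
  simp_rw [iterConv_eq_mixQs hn hp0 hp]
  have h := (hasSum_integral_wSum (poissonWeight_nonneg ht)
    (integrable_Qs (cPois (pMeas p) t) hn σ)).tsum_eq
  unfold mixQs
  rw [← tsum_mul_left]
  refine Eq.trans ?_ h
  congr 1; ext k
  rw [smul_eq_mul, mul_assoc]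

/-- The characteristic function of `log M` where `M` has law `ν`. -/
def logChar (ν : Measure ℕ) (θ : ℝ) : ℂ := ∫ m, Complex.exp (θ * Real.log m * Complex.I) ∂ν

theorem integrable_cexp_log (ν : Measure ℕ) [IsFiniteMeasure ν] (θ : ℝ) :
    Integrable (fun m : ℕ => Complex.exp (θ * Real.log m * Complex.I)) ν :=
  Integrable.of_bound .of_discrete 1 (Eventually.of_forall fun m => by
    rw [← Complex.ofReal_mul, Complex.norm_exp_ofReal_mul_I])

theorem logChar_mPow {P : Measure ℕ} [IsProbabilityMeasure P] (h0 : P {0} = 0) (θ : ℝ) (k : ℕ) :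
    logChar (mPow P k) θ = logChar P θ ^ k := by
  induction k with
  | zero => simp [logChar, mPow]
  | succ k ih =>
    unfold logChar at ih ⊢
    unfold mPow
    rw [integral_mconv (integrable_cexp_log _ θ), pow_succ', ← ih, ← integral_mul_const]
    refine integral_congr_ae ?_
    filter_upwards [ae_ne_zero h0] with a ha
    rw [← integral_const_mul]
    refine integral_congr_ae ?_
    filter_upwards [ae_ne_zero (mPow_singleton_zero h0 k)] with b hb
    rw [← Complex.exp_add, Nat.cast_mul, Real.log_mul (by exact_mod_cast ha) (by exact_mod_cast hb)]
    push_cast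
    ring_nf

theorem logChar_cPois {P : Measure ℕ} [IsProbabilityMeasure P] (h0 : P {0} = 0) {t : ℝ}
    (ht : 0 ≤ t) (θ : ℝ) :
    logChar (cPois P t) θ = Complex.exp (t * (logChar P θ - 1)) := by
  have := isProbabilityMeasure_cPois P ht
  have h := hasSum_integral_wSum (poissonWeight_nonneg ht)
    (integrable_cexp_log (cPois P t) θ)
  refine h.unique ?_
  have h2 := (NormedSpace.expSeries_div_hasSum_exp (t * logChar P θ)).mul_left
    (Complex.exp (-t))
  rw [← Complex.exp_eq_exp_ℂ, ← Complex.exp_add] at h2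
  have e : -(t : ℂ) + t * logChar P θ = t * (logChar P θ - 1) := by ring
  rw [e] at h2
  have e2 : (fun k : ℕ => (Real.exp (-t) * (t ^ k / k.factorial)) •
      ∫ m, Complex.exp (θ * Real.log m * Complex.I) ∂mPow P k) =
      fun k : ℕ => Complex.exp (-t) * ((t * logChar P θ) ^ k / k.factorial) := by
    ext k
    have := logChar_mPow h0 θ k
    unfold logChar at this ⊢
    rw [this, Complex.real_smul]
    push_cast
    ring
  rw [e2]
  exact h2

/-- The second order Taylor remainder of `exp (i x)`. -/
def expRem (x : ℝ) : ℂ := Complex.exp (x * Complex.I) - 1 - x * Complex.I + x ^ 2 / 2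

theorem norm_expRem_le_of_abs_le_one {x : ℝ} (hx : |x| ≤ 1) : ‖expRem x‖ ≤ |x| ^ 3 := by
  have hn : ‖(x : ℂ) * Complex.I‖ = |x| := by simp
  have h := Complex.exp_bound (x := x * Complex.I) (by rw [hn]; exact hx) (n := 3) (by norm_num)
  rw [hn] at h
  have e : Complex.exp (x * Complex.I) - ∑ m ∈ Finset.range 3, (x * Complex.I) ^ m / m.factorial =
      expRem x := by
    simp only [Finset.sum_range_succ, Finset.sum_range_zero, expRem, mul_pow, Complex.I_sq]
    simp [Nat.factorial]
    ring
  rw [e] at h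
  refine h.trans ?_
  have : 0 ≤ |x| ^ 3 := by positivity
  norm_num [Nat.factorial]
  nlinarith

theorem norm_expRem_le_of_one_le_abs {x : ℝ} (hx : 1 ≤ |x|) : ‖expRem x‖ ≤ 4 * |x| ^ 2 := by
  unfold expRem
  have h1 : ‖Complex.exp (x * Complex.I)‖ = 1 := Complex.norm_exp_ofReal_mul_I x
  have h2 : ‖(x : ℂ) * Complex.I‖ = |x| := by simp
  have h3 : ‖(x : ℂ) ^ 2 / 2‖ = |x| ^ 2 / 2 := by simp
  have h4 := norm_add_le (Complex.exp (x * Complex.I) - 1 - x * Complex.I) ((x : ℂ) ^ 2 / 2)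
  have h5 := norm_sub_le (Complex.exp (x * Complex.I) - 1) (x * Complex.I)
  have h6 := norm_sub_le (Complex.exp (x * Complex.I)) 1
  rw [norm_one] at h6
  nlinarith

theorem norm_expRem_le_sq (x : ℝ) : ‖expRem x‖ ≤ 4 * |x| ^ 2 := by
  rcases le_total |x| 1 with h | h
  · refine (norm_expRem_le_of_abs_le_one h).trans ?_
    nlinarith [abs_nonneg x, sq_nonneg |x|]
  · exact norm_expRem_le_of_one_le_abs h

theorem norm_expRem_le_cube (x : ℝ) : ‖expRem x‖ ≤ 4 * |x| ^ 3 := by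
  rcases le_total |x| 1 with h | h
  · refine (norm_expRem_le_of_abs_le_one h).trans ?_
    have : 0 ≤ |x| ^ 3 := by positivity
    linarith
  · refine (norm_expRem_le_of_one_le_abs h).trans ?_
    nlinarith [abs_nonneg x, sq_nonneg |x|]

theorem norm_integral_expRem_le {P : Measure ℕ}
    (h2 : Integrable (fun m : ℕ => Real.log m ^ 2) P) (θ : ℝ)
    {s δ : ℝ} (hs : 0 < s) (hδ : 0 < δ) :
    ‖∫ m, expRem (θ / s * Real.log m) ∂P‖ ≤
      4 * |θ| ^ 3 * δ / s ^ 2 * ∫ m, Real.log m ^ 2 ∂P + 4 * θ ^ 2 / s ^ 2 *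
        ∫ m : ℕ, (if δ * s < Real.log m then Real.log m ^ 2 else 0) ∂P := by
  have hi : Integrable (fun m : ℕ => if δ * s < Real.log m then Real.log m ^ 2 else 0) P := by
    refine Integrable.mono' h2 .of_discrete (Eventually.of_forall fun m => ?_)
    split_ifs
    · simp
    · simp; positivity
  rw [← integral_const_mul, ← integral_const_mul,
    ← integral_add (h2.const_mul _) (hi.const_mul _)]
  refine norm_integral_le_of_norm_le ((h2.const_mul _).add (hi.const_mul _))
    (Eventually.of_forall fun m => ?_)
  have hl := Real.log_natCast_nonneg m
  split_ifs with h
  · refine (norm_expRem_le_sq _).trans ?_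
    have : 4 * |θ / s * Real.log m| ^ 2 = 4 * θ ^ 2 / s ^ 2 * Real.log m ^ 2 := by
      rw [sq_abs]; field_simp
    rw [this]
    have : 0 ≤ 4 * |θ| ^ 3 * δ / s ^ 2 * Real.log m ^ 2 := by positivity
    linarith
  · refine (norm_expRem_le_cube _).trans ?_
    rw [abs_mul, abs_div, abs_of_pos hs, abs_of_nonneg hl, mul_zero, add_zero]
    have : 4 * (|θ| / s * Real.log m) ^ 3 =
      4 * |θ| ^ 3 / s ^ 2 * Real.log m ^ 2 * (Real.log m / s) := by
        field_simp
    rw [this]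
    have h' : Real.log m / s ≤ δ := by rw [div_le_iff₀ hs]; linarith
    calc _ ≤ 4 * |θ| ^ 3 / s ^ 2 * Real.log m ^ 2 * δ := by gcongr
      _ = _ := by ring

section CharFun

variable {P : Measure ℕ} [IsProbabilityMeasure P]

theorem integrable_log_of_sq (h2 : Integrable (fun m : ℕ => Real.log m ^ 2) P) :
    Integrable (fun m : ℕ => Real.log m) P := by
  refine Integrable.mono' (h2.add (integrable_const 1)) .of_discrete
    (Eventually.of_forall fun m => ?_)
  have h0 := Real.log_natCast_nonneg m
  rw [Real.norm_eq_abs, abs_of_nonneg h0]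
  simp only [Pi.add_apply]
  nlinarith [sq_nonneg (Real.log m - 1)]

/-- The law of `(log M - a) / s` for `M` of law `ν`. -/
def normLaw (ν : Measure ℕ) (a s : ℝ) : Measure ℝ := ν.map fun m : ℕ => (Real.log m - a) / s

theorem charFun_normLaw (ν : Measure ℕ) (a s θ : ℝ) :
    charFun (normLaw ν a s) θ = Complex.exp (-(θ * a / s) * Complex.I) * logChar ν (θ / s) := by
  unfold normLaw logChar
  rw [charFun_apply_real, integral_map .of_discrete (by fun_prop), ← integral_const_mul]
  congr 1; ext m
  rw [← Complex.exp_add]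
  congr 1
  push_cast
  ring

theorem logChar_sub_eq_integral_expRem (h2 : Integrable (fun m : ℕ => Real.log m ^ 2) P) (u : ℝ) :
    logChar P u - 1 - u * (∫ m, Real.log m ∂P : ℝ) * Complex.I +
      u ^ 2 * (∫ m, Real.log m ^ 2 ∂P : ℝ) / 2 = ∫ m, expRem (u * Real.log m) ∂P := by
  have h1 := integrable_log_of_sq h2
  have e : ∀ m : ℕ, expRem (u * Real.log m) = Complex.exp (u * Real.log m * Complex.I) - 1 -
      (u * Complex.I) * (Real.log m : ℝ) + (u ^ 2 / 2) * ((Real.log m ^ 2 : ℝ) : ℂ) := by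
    intro m
    unfold expRem
    push_cast
    ring
  have i1 := integrable_cexp_log P u
  have i2 : Integrable (fun _ : ℕ => (1 : ℂ)) P := integrable_const _
  have i3 : Integrable (fun m : ℕ => (u * Complex.I) * ((Real.log m : ℝ) : ℂ)) P :=
    h1.ofReal.const_mul _
  have i4 : Integrable (fun m : ℕ => ((u : ℂ) ^ 2 / 2) * ((Real.log m ^ 2 : ℝ) : ℂ)) P :=
    h2.ofReal.const_mul _
  have i5 : Integrable (fun m : ℕ => Complex.exp (u * Real.log m * Complex.I) - 1) P := i1.sub i2
  have i6 : Integrable (fun m : ℕ => Complex.exp (u * Real.log m * Complex.I) - 1 -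
    (u * Complex.I) * ((Real.log m : ℝ) : ℂ)) P := i5.sub i3
  simp_rw [e]
  rw [integral_add i6 i4, integral_sub i5 i3, integral_sub i1 i2,
    integral_const_mul, integral_const_mul, integral_complex_ofReal,
    integral_complex_ofReal]
  unfold logChar
  simp
  ring

theorem exists_charFun_normLaw_cPois (h0 : P {0} = 0)
    (h2 : Integrable (fun m : ℕ => Real.log m ^ 2) P) {t s : ℝ} (ht : 0 ≤ t) (hs : 0 < s)
    (hs2 : s ^ 2 = t * ∫ m, Real.log m ^ 2 ∂P) (θ : ℝ) :
    ∃ z : ℂ, charFun (normLaw (cPois P t) (t * ∫ m, Real.log m ∂P) s) θ = Complex.exp z ∧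
      ∀ δ : ℝ, 0 < δ → ‖z + θ ^ 2 / 2‖ ≤ 4 * |θ| ^ 3 * δ + 4 * θ ^ 2 *
        ((∫ m : ℕ, (if δ * s < Real.log m then Real.log m ^ 2 else 0) ∂P) /
          ∫ m, Real.log m ^ 2 ∂P) := by
  set μ := ∫ m, Real.log m ∂P with hμ
  set v := ∫ m, Real.log m ^ 2 ∂P with hv
  have hv0 : 0 < v := by
    have : 0 < s ^ 2 := by positivity
    rw [hs2] at this
    exact pos_of_mul_pos_right this ht
  have ht0 : 0 < t := by
    have : 0 < s ^ 2 := by positivity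
    rw [hs2] at this
    exact pos_of_mul_pos_left this hv0.le
  refine ⟨t * (logChar P (θ / s) - 1) - θ * (t * μ) / s * Complex.I, ?_, fun δ hδ => ?_⟩
  · rw [charFun_normLaw, logChar_cPois h0 ht, ← Complex.exp_add]
    congr 1
    push_cast
    ring
  · have hsC : (s : ℂ) ≠ 0 := by exact_mod_cast hs.ne'
    have hs2C : (s : ℂ) ^ 2 = t * v := by exact_mod_cast hs2
    have e : (t : ℂ) * (logChar P (θ / s) - 1) - θ * (t * μ) / s * Complex.I + θ ^ 2 / 2 =
        t * ∫ m, expRem (θ / s * Real.log m) ∂P := by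
      rw [← logChar_sub_eq_integral_expRem h2]
      have : (θ : ℂ) ^ 2 / 2 = t * (((θ / s : ℝ) : ℂ) ^ 2 * v / 2) := by
        push_cast
        rw [div_pow, hs2C]
        have h1 : (t : ℂ) ≠ 0 := by exact_mod_cast ht0.ne'
        have h2 : (v : ℂ) ≠ 0 := by exact_mod_cast hv0.ne'
        field_simp
      rw [this]
      push_cast
      ring
    rw [e, norm_mul, Complex.norm_real, Real.norm_eq_abs, abs_of_pos ht0]
    refine (mul_le_mul_of_nonneg_left (norm_integral_expRem_le h2 θ hs hδ) ht0.le).trans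
      (le_of_eq ?_)
    rw [hs2, ← hv]
    field_simp

end CharFun

open ProbabilityTheory in
theorem tendsto_cPois_real {P : ℕ → Measure ℕ} (hP : ∀ n, IsProbabilityMeasure (P n))
    (h0 : ∀ n, P n {0} = 0) (h2 : ∀ n, Integrable (fun m : ℕ => Real.log m ^ 2) (P n))
    {t s : ℕ → ℝ} (ht : ∀ n, 0 ≤ t n) (hs : ∀ n, 0 < s n)
    (hs2 : ∀ n, s n ^ 2 = t n * ∫ m, Real.log m ^ 2 ∂P n)
    (hL : ∀ δ : ℝ, 0 < δ → Tendsto (fun n =>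
      (∫ m : ℕ, (if δ * s n < Real.log m then Real.log m ^ 2 else 0) ∂P n) /
        ∫ m, Real.log m ^ 2 ∂P n) atTop (nhds 0))
    {S : Set ℝ} (hS : MeasurableSet S) (hS' : gaussianReal 0 1 (frontier S) = 0) :
    Tendsto (fun n => (cPois (P n) (t n)).real
      {m : ℕ | (Real.log m - t n * ∫ m, Real.log m ∂P n) / s n ∈ S}) atTop
      (nhds ((gaussianReal 0 1).real S)) := by
  have hc : ∀ n, IsProbabilityMeasure (cPois (P n) (t n)) := fun n =>
    isProbabilityMeasure_cPois (P n) (ht n)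
  have hN : ∀ n, IsProbabilityMeasure
      (normLaw (cPois (P n) (t n)) (t n * ∫ m, Real.log m ∂P n) (s n)) := fun n =>
    Measure.isProbabilityMeasure_map .of_discrete
  let G : ProbabilityMeasure ℝ := ⟨gaussianReal 0 1, inferInstance⟩
  let L : ℕ → ProbabilityMeasure ℝ := fun n => ⟨_, hN n⟩
  have hlim : Tendsto L atTop (nhds G) := by
    refine ProbabilityMeasure.tendsto_of_tendsto_charFun fun θ => ?_
    choose z hz1 hz2 using fun n =>
      exists_charFun_normLaw_cPois (h0 n) (h2 n) (ht n) (hs n) (hs2 n) θ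
    have hG : charFun (G : Measure ℝ) θ = Complex.exp (-(θ ^ 2 / 2)) := by
      simp only [G, ProbabilityMeasure.coe_mk, charFun_gaussianReal]
      congr 1
      simp
    rw [hG]
    have hz : Tendsto z atTop (nhds (-(θ ^ 2 / 2))) := by
      rw [tendsto_iff_norm_sub_tendsto_zero]
      simp only [sub_neg_eq_add]
      rw [Metric.tendsto_atTop]
      intro ε hε
      set δ : ℝ := ε / (2 * (4 * |θ| ^ 3 + 1)) with hδ
      have hδ0 : 0 < δ := by positivity
      have h3 := (hL δ hδ0).const_mul (4 * θ ^ 2)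
      rw [mul_zero] at h3
      obtain ⟨N, hN⟩ := eventually_atTop.1 (h3.eventually_lt_const (half_pos hε))
      refine ⟨N, fun n hn => ?_⟩
      rw [dist_zero_right, norm_norm]
      refine (hz2 n δ hδ0).trans_lt ?_
      have h4 : 4 * |θ| ^ 3 * δ ≤ ε / 2 := by
        rw [hδ, mul_div_assoc', div_le_div_iff₀ (by positivity) (by positivity)]
        nlinarith [abs_nonneg θ]
      linarith [hN n hn]
    refine ((Complex.continuous_exp.tendsto _).comp hz).congr fun n => ?_
    exact (hz1 n).symm
  have h := ProbabilityMeasure.tendsto_measure_of_null_frontier_of_tendsto' hlim (E := S) hS'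
  have h := (ENNReal.tendsto_toReal (measure_ne_top (G : Measure ℝ) S)).comp h
  refine h.congr fun n => ?_
  simp only [Function.comp, L, ProbabilityMeasure.coe_mk, normLaw, Measure.real]
  rw [Measure.map_apply .of_discrete hS]
  rfl

theorem integral_norm_sq_eq_one {P : Measure ℕ} {μ σ' : ℝ} (hσ0 : 0 < σ')
    (hσ : σ' ^ 2 = ∫ m : ℕ, (Real.log m - μ) ^ 2 ∂P) :
    ∫ m : ℕ, ((Real.log m - μ) / σ') ^ 2 ∂P = 1 := by
  simp_rw [div_pow]
  rw [integral_div, ← hσ, div_self (by positivity)]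

section SingleMeasure

variable {P : Measure ℕ} [IsProbabilityMeasure P] {μ σ' : ℝ}

theorem integrable_log_sub_sq (h2 : Integrable (fun m : ℕ => Real.log m ^ 2) P) (μ : ℝ) :
    Integrable (fun m : ℕ => (Real.log m - μ) ^ 2) P := by
  have h1 := integrable_log_of_sq h2
  have := (h2.sub (h1.const_mul (2 * μ))).add (integrable_const (μ ^ 2))
  refine this.congr (Eventually.of_forall fun m => ?_)
  simp only [Pi.add_apply, Pi.sub_apply]
  ring

theorem integral_log_sq (h2 : Integrable (fun m : ℕ => Real.log m ^ 2) P)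
    (hμ : μ = ∫ m, Real.log m ∂P) (hσ : σ' ^ 2 = ∫ m : ℕ, (Real.log m - μ) ^ 2 ∂P) :
    ∫ m, Real.log m ^ 2 ∂P = μ ^ 2 + σ' ^ 2 := by
  have h1 := integrable_log_of_sq h2
  have h3 := integrable_log_sub_sq h2 μ
  have h4 : Integrable (fun m : ℕ => 2 * μ * Real.log m) P := h1.const_mul (2 * μ)
  have h5 : Integrable (fun m : ℕ => (Real.log m - μ) ^ 2 + 2 * μ * Real.log m) P := h3.add h4
  have e : ∀ m : ℕ, Real.log m ^ 2 = (Real.log m - μ) ^ 2 + 2 * μ * Real.log m - μ ^ 2 := by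
    intro m; ring
  simp_rw [e]
  rw [integral_sub h5 (integrable_const _), integral_add h3 h4, integral_const_mul, ← hμ, ← hσ]
  simp
  ring

/-- The truncated second moment of the normalised variable `(log X - μ) / σ`. -/
def truncSq (P : Measure ℕ) (μ σ' a : ℝ) : ℝ :=
  ∫ m : ℕ, (if a < ((Real.log m - μ) / σ') ^ 2 then ((Real.log m - μ) / σ') ^ 2 else 0) ∂P

theorem integrable_truncSq (h2 : Integrable (fun m : ℕ => Real.log m ^ 2) P) (μ σ' a : ℝ) :
    Integrable (fun m : ℕ => if a < ((Real.log m - μ) / σ') ^ 2 then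
      ((Real.log m - μ) / σ') ^ 2 else 0) P := by
  refine Integrable.mono' ((integrable_log_sub_sq h2 μ).div_const (σ' ^ 2)) .of_discrete
    (Eventually.of_forall fun m => ?_)
  rw [← div_pow]
  split_ifs
  · rw [Real.norm_eq_abs, abs_of_nonneg (sq_nonneg _)]
  · simp only [norm_zero]; positivity

theorem one_le_add_truncSq (h2 : Integrable (fun m : ℕ => Real.log m ^ 2) P) (hσ0 : 0 < σ')
    (hσ : σ' ^ 2 = ∫ m : ℕ, (Real.log m - μ) ^ 2 ∂P) {a : ℝ} (ha : 0 ≤ a) :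
    1 ≤ a + truncSq P μ σ' a := by
  have hi := integrable_truncSq h2 μ σ' a
  have e : a + truncSq P μ σ' a = ∫ m : ℕ, (a + if a < ((Real.log m - μ) / σ') ^ 2 then
      ((Real.log m - μ) / σ') ^ 2 else 0) ∂P := by
    rw [integral_add (integrable_const _) hi]
    simp [truncSq]
  rw [e, ← integral_norm_sq_eq_one hσ0 hσ]
  refine integral_mono ?_ ((integrable_const _).add hi) fun m => ?_
  · simp_rw [div_pow]; exact (integrable_log_sub_sq h2 μ).div_const _
  · simp only
    split_ifs with h <;> linarith

theorem one_le_mul_add_truncSq (h2 : Integrable (fun m : ℕ => Real.log m ^ 2) P)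
    (hσ0 : 0 < σ') (hμ0 : 0 < μ) (hμ : μ = ∫ m, Real.log m ∂P)
    (hσ : σ' ^ 2 = ∫ m : ℕ, (Real.log m - μ) ^ 2 ∂P) (a : ℝ) :
    1 ≤ Real.sqrt a * (2 * μ / σ') + truncSq P μ σ' a := by
  have hi := integrable_truncSq h2 μ σ' a
  have h1 := integrable_log_of_sq h2
  have hξ : Integrable (fun m : ℕ => (Real.log m - μ) / σ') P :=
    (h1.sub (integrable_const _)).div_const _
  have hξ0 : ∫ m : ℕ, (Real.log m - μ) / σ' ∂P = 0 := by
    rw [integral_div, integral_sub h1 (integrable_const _), ← hμ]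
    simp
  have hj : Integrable (fun m : ℕ => (Real.log m - μ) / σ' + 2 * μ / σ') P :=
    hξ.add (integrable_const _)
  have e : Real.sqrt a * (2 * μ / σ') =
      ∫ m : ℕ, Real.sqrt a * ((Real.log m - μ) / σ' + 2 * μ / σ') ∂P := by
    rw [integral_const_mul, integral_add hξ (integrable_const _), hξ0]
    simp
  rw [← integral_norm_sq_eq_one hσ0 hσ, e]
  unfold truncSq
  rw [← integral_add (hj.const_mul _) hi]
  refine integral_mono ?_ ((hj.const_mul _).add hi) fun m => ?_
  · simp_rw [div_pow]; exact (integrable_log_sub_sq h2 μ).div_const _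
  · have hl := Real.log_natCast_nonneg m
    have h3 : |(Real.log m - μ) / σ'| ≤ (Real.log m - μ) / σ' + 2 * μ / σ' := by
      rw [abs_div, abs_of_pos hσ0, ← add_div]
      gcongr
      rw [abs_le]
      constructor <;> linarith
    have h4 : 0 ≤ (Real.log m - μ) / σ' + 2 * μ / σ' := (abs_nonneg _).trans h3
    simp only
    split_ifs with h
    · have : 0 ≤ Real.sqrt a * ((Real.log m - μ) / σ' + 2 * μ / σ') := by positivity
      linarith
    · rw [not_lt] at h
      have h5 : |(Real.log m - μ) / σ'| ≤ Real.sqrt a := Real.abs_le_sqrt h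
      rw [add_zero, ← sq_abs, sq]
      gcongr

theorem truncLog_le (h2 : Integrable (fun m : ℕ => Real.log m ^ 2) P)
    (hσ0 : 0 < σ') {a l : ℝ} (hl : 2 * μ ≤ l) (hl0 : 0 ≤ l) (hal : 4 * σ' ^ 2 * a ≤ l ^ 2) :
    ∫ m : ℕ, (if l < Real.log m then Real.log m ^ 2 else 0) ∂P ≤
      4 * σ' ^ 2 * truncSq P μ σ' a := by
  unfold truncSq
  rw [← integral_const_mul]
  have hi := integrable_truncSq h2 μ σ' a
  refine integral_mono_of_nonneg (Eventually.of_forall fun m => ?_) (hi.const_mul _)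
    (Eventually.of_forall fun m => ?_)
  · simp only [Pi.zero_apply]; split_ifs <;> positivity
  · simp only
    split_ifs with h h' h'
    · rw [div_pow]
      have : 4 * σ' ^ 2 * ((Real.log m - μ) ^ 2 / σ' ^ 2) = (2 * (Real.log m - μ)) ^ 2 := by
        field_simp; ring
      rw [this]
      have := Real.log_natCast_nonneg m
      gcongr
      linarith
    · exfalso
      apply h'
      rw [div_pow, lt_div_iff₀ (by positivity)]
      have : l / 2 < Real.log m - μ := by linarith
      have : (l / 2) ^ 2 < (Real.log m - μ) ^ 2 := by gcongr
      nlinarith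
    · positivity
    · simp

end SingleMeasure

/-- The standing assumptions on the laws `P n` of `X_n`: `log X_n` has mean `μ n > 0`, variance
`σ' n ^ 2 > 0`, and satisfies the Lindeberg-type condition. -/
structure LindebergSeq (P : ℕ → Measure ℕ) (μ σ' : ℕ → ℝ) : Prop where
  prob : ∀ n, IsProbabilityMeasure (P n)
  zero : ∀ n, P n {0} = 0
  int_sq : ∀ n, Integrable (fun m : ℕ => Real.log m ^ 2) (P n)
  mean_pos : ∀ n, 0 < μ n
  sd_pos : ∀ n, 0 < σ' n
  mean_eq : ∀ n, μ n = ∫ m, Real.log m ∂P n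
  var_eq : ∀ n, σ' n ^ 2 = ∫ m : ℕ, (Real.log m - μ n) ^ 2 ∂P n
  lindeberg : ∀ ε : ℝ, 0 < ε →
    Tendsto (fun n : ℕ => truncSq (P n) (μ n) (σ' n) (ε * Real.log n / μ n)) atTop (nhds 0)

theorem eventually_log_pos : ∀ᶠ n : ℕ in atTop, 0 < Real.log n := by
  filter_upwards [eventually_ge_atTop 2] with n hn
  exact Real.log_pos (by exact_mod_cast hn)

namespace LindebergSeq

variable {P : ℕ → Measure ℕ} {μ σ' : ℕ → ℝ}

theorem tendsto_mean_div_log (h : LindebergSeq P μ σ') :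
    Tendsto (fun n => μ n / Real.log n) atTop (nhds 0) := by
  rw [Metric.tendsto_atTop']
  intro ε hε
  have h1 := (h.lindeberg (ε / 4) (by positivity)).eventually_lt_const
    (show (0 : ℝ) < 1 / 2 by norm_num)
  obtain ⟨N, hN⟩ := eventually_atTop.1 (h1.and eventually_log_pos)
  refine ⟨N, fun n hn => ?_⟩
  obtain ⟨h1, hl⟩ := hN n hn.le
  have := h.prob n
  have hμ := h.mean_pos n
  have h2 := one_le_add_truncSq (h.int_sq n) (h.sd_pos n) (h.var_eq n)
    (a := ε / 4 * Real.log n / μ n) (by positivity)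
  have h3 : 1 / 2 ≤ ε / 4 * Real.log n / μ n := by linarith
  rw [le_div_iff₀ hμ] at h3
  rw [Real.dist_0_eq_abs, abs_of_pos (by positivity), div_lt_iff₀ hl]
  nlinarith

theorem tendsto_sd_sq_div (h : LindebergSeq P μ σ') :
    Tendsto (fun n => σ' n ^ 2 / (μ n * Real.log n)) atTop (nhds 0) := by
  rw [Metric.tendsto_atTop']
  intro ε hε
  have h1 := (h.lindeberg (ε / 32) (by positivity)).eventually_lt_const
    (show (0 : ℝ) < 1 / 2 by norm_num)
  obtain ⟨N, hN⟩ := eventually_atTop.1 (h1.and eventually_log_pos)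
  refine ⟨N, fun n hn => ?_⟩
  obtain ⟨h1, hl⟩ := hN n hn.le
  have := h.prob n
  have hμ := h.mean_pos n
  have hσ := h.sd_pos n
  have h2 := one_le_mul_add_truncSq (h.int_sq n) hσ hμ (h.mean_eq n) (h.var_eq n)
    (ε / 32 * Real.log n / μ n)
  have h3 : 1 / 2 ≤ Real.sqrt (ε / 32 * Real.log n / μ n) * (2 * μ n / σ' n) := by linarith
  rw [mul_div_assoc', le_div_iff₀ hσ] at h3
  have h4 : (1 / 2 * σ' n) ^ 2 ≤ (Real.sqrt (ε / 32 * Real.log n / μ n) * (2 * μ n)) ^ 2 := by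
    gcongr
  rw [mul_pow, mul_pow, Real.sq_sqrt (by positivity)] at h4
  have h5 : ε / 32 * Real.log n / μ n * (2 * μ n) ^ 2 = ε / 8 * (μ n * Real.log n) := by
    field_simp; ring
  have h6 : 0 < ε * (μ n * Real.log n) := by positivity
  rw [Real.dist_0_eq_abs, abs_of_pos (by positivity), div_lt_iff₀ (by positivity)]
  nlinarith

end LindebergSeq

/-- The window size `max{(μ + σ) √(log n / μ), 1}` on the scale of `log X`. -/
def logWindow (μ σ' : ℕ → ℝ) (n : ℕ) : ℝ :=
  max ((μ n + σ' n) * Real.sqrt (Real.log n / μ n)) 1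

/-- The time `t_n + c b_n`. -/
def windowTime (μ σ' : ℕ → ℝ) (c : ℝ) (n : ℕ) : ℝ :=
  3 * Real.log n / (2 * μ n) + c * ((1 / μ n) * logWindow μ σ' n)

theorem one_le_logWindow (μ σ' : ℕ → ℝ) (n : ℕ) : 1 ≤ logWindow μ σ' n := le_max_right _ _

theorem tendsto_log_natCast : Tendsto (fun n : ℕ => Real.log n) atTop atTop :=
  Real.tendsto_log_atTop.comp tendsto_natCast_atTop_atTop

namespace LindebergSeq

variable {P : ℕ → Measure ℕ} {μ σ' : ℕ → ℝ}

theorem tendsto_logWindow_div_log (h : LindebergSeq P μ σ') :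
    Tendsto (fun n => logWindow μ σ' n / Real.log n) atTop (nhds 0) := by
  have h1 : Tendsto (fun n => Real.sqrt (2 * (μ n / Real.log n +
      σ' n ^ 2 / (μ n * Real.log n)))) atTop (nhds 0) := by
    have := ((h.tendsto_mean_div_log.add h.tendsto_sd_sq_div).const_mul 2).sqrt
    simpa using this
  have h2 := h1.max tendsto_log_natCast.inv_tendsto_atTop
  rw [max_self] at h2
  refine tendsto_of_tendsto_of_tendsto_of_le_of_le' tendsto_const_nhds h2 ?_ ?_
  · filter_upwards [eventually_log_pos] with n hl
    have := one_le_logWindow μ σ' n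
    positivity
  · filter_upwards [eventually_log_pos] with n hl
    have hμ := h.mean_pos n
    have hσ := h.sd_pos n
    rw [logWindow, div_le_iff₀ hl, max_mul_of_nonneg _ _ hl.le, Pi.inv_apply,
      inv_mul_cancel₀ hl.ne']
    refine max_le_max ?_ le_rfl
    refine le_of_sq_le_sq ?_ (by positivity)
    rw [mul_pow, mul_pow, Real.sq_sqrt (by positivity), Real.sq_sqrt (by positivity)]
    have e : 2 * (μ n / Real.log n + σ' n ^ 2 / (μ n * Real.log n)) * Real.log n ^ 2 =
        2 * (μ n ^ 2 + σ' n ^ 2) * (Real.log n / μ n) := by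
      field_simp
    rw [e]
    gcongr
    nlinarith [sq_nonneg (μ n - σ' n)]

theorem eventually_windowTime_mem (h : LindebergSeq P μ σ') (c : ℝ) :
    ∀ᶠ n : ℕ in atTop, Real.log n / μ n ≤ windowTime μ σ' c n ∧
      windowTime μ σ' c n ≤ 2 * (Real.log n / μ n) := by
  have h1 := h.tendsto_logWindow_div_log.const_mul |c|
  rw [mul_zero] at h1
  filter_upwards [eventually_log_pos, h1.eventually_lt_const (show (0 : ℝ) < 1 / 2 by norm_num)]
    with n hl hn
  have hμ := h.mean_pos n
  have hw := one_le_logWindow μ σ' n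
  rw [mul_div_assoc', div_lt_iff₀ hl] at hn
  have h3 : |c * logWindow μ σ' n| ≤ 1 / 2 * Real.log n := by
    rw [abs_mul, abs_of_pos (by linarith : 0 < logWindow μ σ' n)]; exact hn.le
  rw [abs_le] at h3
  have e : windowTime μ σ' c n = (3 / 2 * Real.log n + c * logWindow μ σ' n) / μ n := by
    unfold windowTime; field_simp
  rw [e, mul_div_assoc']
  constructor <;> gcongr <;> linarith

theorem exists_scale (h : LindebergSeq P μ σ') (c : ℝ) :
    ∃ s : ℕ → ℝ, (∀ n, 0 < s n) ∧
      (∀ᶠ n in atTop, (μ n + σ' n) * Real.sqrt (Real.log n / μ n) ≤ 2 * s n ∧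
        s n ≤ 2 * logWindow μ σ' n) ∧
      ∀ S : Set ℝ, MeasurableSet S → ProbabilityTheory.gaussianReal 0 1 (frontier S) = 0 →
        Tendsto (fun n : ℕ => (cPois (P n) (windowTime μ σ' c n)).real
          {m : ℕ | (Real.log m - (3 / 2 * Real.log n + c * logWindow μ σ' n)) / s n ∈ S})
          atTop (nhds ((ProbabilityTheory.gaussianReal 0 1).real S)) := by
  set τ : ℕ → ℝ := fun n => if 0 < windowTime μ σ' c n then windowTime μ σ' c n else 1 with hτ
  have hτ0 : ∀ n, 0 < τ n := fun n => by
    simp only [hτ]; split_ifs with h1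
    · exact h1
    · exact one_pos
  have hv : ∀ n, 0 < μ n ^ 2 + σ' n ^ 2 := fun n => by have := h.mean_pos n; positivity
  have hv' : ∀ n, ∫ m, Real.log m ^ 2 ∂P n = μ n ^ 2 + σ' n ^ 2 := fun n => by
    have := h.prob n
    exact integral_log_sq (h.int_sq n) (h.mean_eq n) (h.var_eq n)
  set s : ℕ → ℝ := fun n => Real.sqrt (τ n * (μ n ^ 2 + σ' n ^ 2)) with hs
  have hs0 : ∀ n, 0 < s n := fun n => Real.sqrt_pos.2 (mul_pos (hτ0 n) (hv n))
  have hs2 : ∀ n, s n ^ 2 = τ n * (μ n ^ 2 + σ' n ^ 2) := fun n =>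
    Real.sq_sqrt (mul_pos (hτ0 n) (hv n)).le
  have hev : ∀ᶠ n : ℕ in atTop, τ n = windowTime μ σ' c n ∧
      Real.log n / μ n * (μ n ^ 2 + σ' n ^ 2) ≤ s n ^ 2 ∧
      s n ^ 2 ≤ 2 * (Real.log n / μ n) * (μ n ^ 2 + σ' n ^ 2) := by
    filter_upwards [h.eventually_windowTime_mem c, eventually_log_pos] with n hn hl
    have hμ := h.mean_pos n
    have hl' : 0 < Real.log n / μ n := by positivity
    have e : τ n = windowTime μ σ' c n := if_pos (hl'.trans_le hn.1)
    have := (hv n).le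
    refine ⟨e, ?_, ?_⟩ <;> rw [hs2, e] <;> gcongr
    exacts [hn.1, hn.2]
  refine ⟨s, hs0, ?_, ?_⟩
  · filter_upwards [hev, eventually_log_pos] with n hn hl
    obtain ⟨-, h1, h2⟩ := hn
    have hμ := h.mean_pos n
    have hσ := h.sd_pos n
    have hl' : 0 < Real.log n / μ n := by positivity
    have hr : ((μ n + σ' n) * Real.sqrt (Real.log n / μ n)) ^ 2 =
        Real.log n / μ n * (μ n + σ' n) ^ 2 := by
      rw [mul_pow, Real.sq_sqrt hl'.le, mul_comm]
    have h3 : Real.log n / μ n * (μ n + σ' n) ^ 2 ≤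
        Real.log n / μ n * (2 * (μ n ^ 2 + σ' n ^ 2)) := by
      gcongr; nlinarith [sq_nonneg (μ n - σ' n)]
    have h4 : Real.log n / μ n * (μ n ^ 2 + σ' n ^ 2) ≤
        Real.log n / μ n * (μ n + σ' n) ^ 2 := by
      gcongr; nlinarith [mul_pos hμ hσ]
    have := hs0 n
    constructor
    · refine le_of_sq_le_sq ?_ (by positivity)
      rw [hr, mul_pow]; nlinarith [sq_nonneg (s n)]
    · have h5 : s n ≤ 2 * ((μ n + σ' n) * Real.sqrt (Real.log n / μ n)) := by
        refine le_of_sq_le_sq ?_ (by positivity)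
        rw [mul_pow, hr]; nlinarith [sq_nonneg (s n)]
      have h6 : (μ n + σ' n) * Real.sqrt (Real.log n / μ n) ≤ logWindow μ σ' n := le_max_left _ _
      linarith
  · intro S hS hS'
    have key := tendsto_cPois_real h.prob h.zero h.int_sq (t := τ) (s := s)
      (fun n => (hτ0 n).le) hs0 (fun n => by rw [hs2, hv']) ?_ hS hS'
    · refine key.congr' ?_
      filter_upwards [hev] with n hn
      have hμ := h.mean_pos n
      have e : windowTime μ σ' c n * μ n = 3 / 2 * Real.log n + c * logWindow μ σ' n := by
        unfold windowTime; field_simp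
      rw [hn.1, ← h.mean_eq n, e]
    · intro δ hδ
      have hL := (h.lindeberg (δ ^ 2 / 4) (by positivity)).const_mul 4
      rw [mul_zero] at hL
      refine tendsto_of_tendsto_of_tendsto_of_le_of_le' tendsto_const_nhds hL ?_ ?_
      · refine Eventually.of_forall fun n => div_nonneg (integral_nonneg fun m => ?_) ?_
        · simp only [Pi.zero_apply]; split_ifs <;> positivity
        · rw [hv']; exact (hv n).le
      · filter_upwards [hev, eventually_log_pos, h.tendsto_mean_div_log.eventually_lt_const
          (show (0 : ℝ) < δ ^ 2 / 4 by positivity)] with n hn hl ha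
        obtain ⟨-, h1, -⟩ := hn
        have := h.prob n
        have hμ := h.mean_pos n
        have hσ := h.sd_pos n
        have hs0 := hs0 n
        rw [hv', div_le_iff₀ (hv n)]
        rw [div_lt_iff₀ hl] at ha
        have hb := truncLog_le (h.int_sq n) hσ (μ := μ n) (a := δ ^ 2 / 4 * Real.log n / μ n)
          (l := δ * s n) ?_ (by positivity) ?_
        · refine hb.trans ?_
          have : 0 ≤ truncSq (P n) (μ n) (σ' n) (δ ^ 2 / 4 * Real.log n / μ n) := by
            refine integral_nonneg fun m => ?_
            simp only [Pi.zero_apply]; split_ifs <;> positivity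
          nlinarith [mul_nonneg (sq_nonneg (μ n)) this]
        · refine le_of_sq_le_sq ?_ (by positivity)
          have h3 : Real.log n * μ n ≤ Real.log n / μ n * (μ n ^ 2 + σ' n ^ 2) := by
            rw [div_mul_eq_mul_div, le_div_iff₀ hμ]; nlinarith [sq_nonneg (σ' n)]
          have h4 : δ ^ 2 * (Real.log n * μ n) ≤ δ ^ 2 * s n ^ 2 := by
            gcongr; exact h3.trans h1
          rw [mul_pow, mul_pow]
          nlinarith
        · have h3 : Real.log n / μ n * σ' n ^ 2 ≤ s n ^ 2 := by
            refine le_trans ?_ h1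
            have : 0 < Real.log n / μ n := by positivity
            gcongr
            nlinarith [sq_nonneg (μ n)]
          have h4 : δ ^ 2 * (Real.log n / μ n * σ' n ^ 2) ≤ δ ^ 2 * s n ^ 2 := by gcongr
          rw [mul_pow]
          refine le_trans (le_of_eq ?_) h4
          ring

end LindebergSeq

theorem gaussianReal_frontier_Iic (x : ℝ) :
    ProbabilityTheory.gaussianReal 0 1 (frontier (Set.Iic x)) = 0 := by
  have := ProbabilityTheory.nullSingletonClass_gaussianReal (μ := 0) (v := 1) one_ne_zero
  rw [frontier_Iic]
  exact measure_singleton x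

theorem gaussianReal_frontier_Ioi (x : ℝ) :
    ProbabilityTheory.gaussianReal 0 1 (frontier (Set.Ioi x)) = 0 := by
  have := ProbabilityTheory.nullSingletonClass_gaussianReal (μ := 0) (v := 1) one_ne_zero
  rw [frontier_Ioi]
  exact measure_singleton x

theorem gaussianReal_real_Ioi (x : ℝ) : (ProbabilityTheory.gaussianReal 0 1).real (Set.Ioi x) =
    1 - ProbabilityTheory.cdf (ProbabilityTheory.gaussianReal 0 1) x := by
  rw [ProbabilityTheory.cdf_eq_real, ← Set.compl_Iic, probReal_compl_eq_one_sub measurableSet_Iic]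

theorem gaussianReal_real_pos {S : Set ℝ} (hS : volume S ≠ 0) :
    0 < (ProbabilityTheory.gaussianReal 0 1).real S := by
  rw [measureReal_def, ENNReal.toReal_pos_iff]
  refine ⟨pos_iff_ne_zero.2 fun h => hS ?_, measure_lt_top _ _⟩
  exact ProbabilityTheory.gaussianReal_absolutelyContinuous' 0 one_ne_zero h

theorem limsup_le_of_tendsto_of_le {f g : ℕ → ℝ} {a : ℝ}
    (hf : ∀ᶠ n in atTop, f n ∈ Set.Icc (0 : ℝ) 1)
    (hg : Tendsto g atTop (nhds a)) (hfg : ∀ᶠ n in atTop, f n ≤ g n) :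
    limsup f atTop ≤ a := by
  rw [← hg.limsup_eq]
  have hb : IsBoundedUnder (· ≥ ·) atTop f := ⟨0, eventually_map.2 (hf.mono fun _ h => h.1)⟩
  exact limsup_le_limsup hfg hb.isCoboundedUnder_le hg.isBoundedUnder_le

theorem le_liminf_of_tendsto_of_le {f g : ℕ → ℝ} {a : ℝ}
    (hf : ∀ᶠ n in atTop, f n ∈ Set.Icc (0 : ℝ) 1)
    (hg : Tendsto g atTop (nhds a)) (hfg : ∀ᶠ n in atTop, g n ≤ f n) :
    a ≤ liminf f atTop := by
  rw [← hg.liminf_eq]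
  have hb : IsBoundedUnder (· ≤ ·) atTop f := ⟨1, eventually_map.2 (hf.mono fun _ h => h.2)⟩
  exact liminf_le_liminf hfg hg.isBoundedUnder_ge hb.isCoboundedUnder_ge

theorem limsup_nonneg_of_mem_Icc {f : ℕ → ℝ} (hf : ∀ᶠ n in atTop, f n ∈ Set.Icc (0 : ℝ) 1) :
    0 ≤ limsup f atTop :=
  le_limsup_of_frequently_le (hf.mono fun _ h => h.1).frequently
    ⟨1, eventually_map.2 (hf.mono fun _ h => h.2)⟩

theorem liminf_le_one_of_mem_Icc {f : ℕ → ℝ} (hf : ∀ᶠ n in atTop, f n ∈ Set.Icc (0 : ℝ) 1) :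
    liminf f atTop ≤ 1 :=
  liminf_le_of_frequently_le (hf.mono fun _ h => h.2).frequently
    ⟨0, eventually_map.2 (hf.mono fun _ h => h.1)⟩

/-- The distance to uniformity of the continuous-time shuffle at time `t_n + c b_n`. -/
def windowTV (P : ℕ → Measure ℕ) (μ σ' : ℕ → ℝ) (c : ℝ) (n : ℕ) : ℝ :=
  tv n (mixQs n (cPois (P n) (windowTime μ σ' c n))) (Us n)

namespace LindebergSeq

variable {P : ℕ → Measure ℕ} {μ σ' : ℕ → ℝ}

theorem eventually_windowTime_pos (h : LindebergSeq P μ σ') (c : ℝ) :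
    ∀ᶠ n : ℕ in atTop, 0 < windowTime μ σ' c n := by
  filter_upwards [h.eventually_windowTime_mem c, eventually_log_pos] with n hn hl
  have := h.mean_pos n
  exact lt_of_lt_of_le (by positivity) hn.1

theorem eventually_prob (h : LindebergSeq P μ σ') (c : ℝ) : ∀ᶠ n : ℕ in atTop,
    IsProbabilityMeasure (cPois (P n) (windowTime μ σ' c n)) ∧
      cPois (P n) (windowTime μ σ' c n) {0} = 0 := by
  filter_upwards [h.eventually_windowTime_pos c] with n hn
  have := h.prob n
  exact ⟨isProbabilityMeasure_cPois (P n) hn.le, cPois_singleton_zero (h.zero n) _⟩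

theorem eventually_windowTV_mem (h : LindebergSeq P μ σ') (c : ℝ) :
    ∀ᶠ n in atTop, windowTV P μ σ' c n ∈ Set.Icc (0 : ℝ) 1 := by
  filter_upwards [h.eventually_prob c, eventually_ge_atTop 1] with n hn h1
  have := hn.1
  exact tv_mixQs_mem _ h1 hn.2

theorem limsup_windowTV_le (h : LindebergSeq P μ σ') {c : ℝ} (hc : 0 < c) :
    limsup (windowTV P μ σ' c) atTop ≤ 3 * Real.exp (-(c / 2)) +
      ProbabilityTheory.cdf (ProbabilityTheory.gaussianReal 0 1) (-(c / 4)) := by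
  obtain ⟨s, hs0, hs, hlim⟩ := h.exists_scale c
  rw [ProbabilityTheory.cdf_eq_real]
  refine limsup_le_of_tendsto_of_le (h.eventually_windowTV_mem c)
    (tendsto_const_nhds.add (hlim _ measurableSet_Iic (gaussianReal_frontier_Iic _))) ?_
  · filter_upwards [h.eventually_prob c, eventually_ge_atTop 4, hs] with n hn h4 hs
    have := hn.1
    refine (tv_mixQs_le_of_large _ h4 hn.2 (x := c / 2) (by positivity)).trans ?_
    gcongr with m
    · exact measure_ne_top _ _
    intro hm
    rw [Set.mem_Iic, div_le_iff₀ (hs0 n)]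
    have := mul_le_mul_of_nonneg_left hs.2 hc.le
    have := mul_le_mul_of_nonneg_left (one_le_logWindow μ σ' n) hc.le
    linarith

theorem le_liminf_windowTV (h : LindebergSeq P μ σ') {c : ℝ} (hc : 0 < c) :
    ProbabilityTheory.cdf (ProbabilityTheory.gaussianReal 0 1) (c / 8) -
      100000 * Real.exp (-(c / 2)) ^ 2 ≤ liminf (windowTV P μ σ' (-c)) atTop := by
  obtain ⟨s, hs0, hs, hlim⟩ := h.exists_scale (-c)
  obtain ⟨N, hN⟩ := one_sub_le_tv_mixQs (c / 2)
  have e : ProbabilityTheory.cdf (ProbabilityTheory.gaussianReal 0 1) (c / 8) -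
      100000 * Real.exp (-(c / 2)) ^ 2 = 1 - 100000 * Real.exp (-(c / 2)) ^ 2 -
        (ProbabilityTheory.gaussianReal 0 1).real (Set.Ioi (c / 8)) := by
    rw [gaussianReal_real_Ioi]; ring
  rw [e]
  refine le_liminf_of_tendsto_of_le (h.eventually_windowTV_mem (-c))
    (tendsto_const_nhds.sub (hlim _ measurableSet_Ioi (gaussianReal_frontier_Ioi _))) ?_
  filter_upwards [h.eventually_prob (-c), eventually_ge_atTop N, hs] with n hn h4 hs
  have := hn.1
  refine le_trans ?_ (hN n h4 _ this hn.2)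
  gcongr with m
  · exact measure_ne_top _ _
  intro hm
  rw [Set.mem_Ioi, lt_div_iff₀ (hs0 n)]
  have := mul_le_mul_of_nonneg_left hs.2 hc.le
  have := mul_le_mul_of_nonneg_left (one_le_logWindow μ σ' n) hc.le
  linarith

theorem mul_logWindow_le {c s : ℝ} (hc : 0 < c) (hs0 : 0 < s) {n : ℕ}
    (hs : (μ n + σ' n) * Real.sqrt (Real.log n / μ n) ≤ 2 * s) :
    c * logWindow μ σ' n ≤ c + 2 * c * s := by
  have : logWindow μ σ' n ≤ 1 + 2 * s := max_le (by linarith) (by linarith)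
  nlinarith

theorem liminf_windowTV_pos (h : LindebergSeq P μ σ') {c : ℝ} (hc : 0 < c) :
    0 < liminf (windowTV P μ σ' c) atTop := by
  obtain ⟨s, hs0, hs, hlim⟩ := h.exists_scale c
  obtain ⟨η, hη, hN⟩ := exists_pos_le_tv_mixQs c
  have hpos := gaussianReal_real_pos (S := Set.Iic (-(2 * c))) (by simp)
  refine lt_of_lt_of_le (mul_pos hη hpos) (le_liminf_of_tendsto_of_le (h.eventually_windowTV_mem c)
    ((hlim _ measurableSet_Iic (gaussianReal_frontier_Iic _)).const_mul η) ?_)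
  filter_upwards [h.eventually_prob c, eventually_ge_atTop 2, hs] with n hn h2 hs
  have := hn.1
  refine le_trans ?_ (hN n h2 _ this hn.2)
  gcongr with m
  · exact measure_ne_top _ _
  intro hm
  rw [Set.mem_Iic, div_le_iff₀ (hs0 n)] at hm
  have := mul_logWindow_le hc (hs0 n) hs.1
  linarith

theorem limsup_windowTV_lt_one (h : LindebergSeq P μ σ') {c : ℝ} (hc : 0 < c) :
    limsup (windowTV P μ σ' (-c)) atTop < 1 := by
  obtain ⟨s, hs0, hs, hlim⟩ := h.exists_scale (-c)
  obtain ⟨η, hη, N, hN⟩ := exists_pos_tv_mixQs_le c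
  have hpos := gaussianReal_real_pos (S := Set.Ioi (2 * c)) (by simp)
  refine lt_of_le_of_lt (limsup_le_of_tendsto_of_le (h.eventually_windowTV_mem (-c))
    (((hlim _ measurableSet_Ioi (gaussianReal_frontier_Ioi _)).const_mul η).const_sub 1) ?_)
    (sub_lt_self _ (mul_pos hη hpos))
  filter_upwards [h.eventually_prob (-c), eventually_ge_atTop N, hs] with n hn h2 hs
  have := hn.1
  refine (hN n h2 _ this hn.2).trans ?_
  gcongr with m
  · exact measure_ne_top _ _
  intro hm
  rw [Set.mem_Ioi, lt_div_iff₀ (hs0 n)] at hm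
  have := mul_logWindow_le hc (hs0 n) hs.1
  linarith

theorem tendsto_limsup_windowTV (h : LindebergSeq P μ σ') :
    Tendsto (fun c => limsup (windowTV P μ σ' c) atTop) atTop (nhds 0) := by
  have h1 : Tendsto (fun c : ℝ => 3 * Real.exp (-(c / 2)) +
      ProbabilityTheory.cdf (ProbabilityTheory.gaussianReal 0 1) (-(c / 4))) atTop
      (nhds (3 * 0 + 0)) :=
    ((Real.tendsto_exp_neg_atTop_nhds_zero.comp
      (tendsto_id.atTop_div_const two_pos)).const_mul 3).add
      ((ProbabilityTheory.tendsto_cdf_atBot _).comp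
        (tendsto_neg_atTop_atBot.comp (tendsto_id.atTop_div_const four_pos)))
  rw [mul_zero, zero_add] at h1
  refine tendsto_of_tendsto_of_tendsto_of_le_of_le' tendsto_const_nhds h1
    (Eventually.of_forall fun c => limsup_nonneg_of_mem_Icc (h.eventually_windowTV_mem c)) ?_
  filter_upwards [eventually_gt_atTop 0] with c hc
  exact h.limsup_windowTV_le hc

theorem tendsto_liminf_windowTV (h : LindebergSeq P μ σ') :
    Tendsto (fun c => liminf (windowTV P μ σ' (-c)) atTop) atTop (nhds 1) := by
  have h1 : Tendsto (fun c : ℝ =>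
      ProbabilityTheory.cdf (ProbabilityTheory.gaussianReal 0 1) (c / 8) -
        100000 * Real.exp (-(c / 2)) ^ 2) atTop (nhds (1 - 100000 * 0 ^ 2)) :=
    ((ProbabilityTheory.tendsto_cdf_atTop _).comp
      (tendsto_id.atTop_div_const (by norm_num : (0 : ℝ) < 8))).sub
      (((Real.tendsto_exp_neg_atTop_nhds_zero.comp
        (tendsto_id.atTop_div_const two_pos)).pow 2).const_mul _)
  norm_num at h1
  refine tendsto_of_tendsto_of_tendsto_of_le_of_le' h1 tendsto_const_nhds ?_
    (Eventually.of_forall fun c => liminf_le_one_of_mem_Icc (h.eventually_windowTV_mem (-c)))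
  filter_upwards [eventually_gt_atTop 0] with c hc
  exact h.le_liminf_windowTV hc

end LindebergSeq

theorem lindebergSeq_pMeas {p : ℕ → ℕ → ℝ} (hp0 : ∀ n k, 0 ≤ p n k)
    (hpz : ∀ n, p n 0 = 0) (hpsum : ∀ n, ∑' k : ℕ, p n k = 1)
    {μ σ' : ℕ → ℝ} (hμpos : ∀ n, 0 < μ n) (hσpos : ∀ n, 0 < σ' n)
    (hsum1 : ∀ n, Summable fun k : ℕ => p n k * Real.log k)
    (hμ : ∀ n, μ n = ∑' k : ℕ, p n k * Real.log k)
    (hsum2 : ∀ n, Summable fun k : ℕ => p n k * (Real.log k - μ n) ^ 2)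
    (hσ : ∀ n, (σ' n) ^ 2 = ∑' k : ℕ, p n k * (Real.log k - μ n) ^ 2)
    (hLind : ∀ ε : ℝ, 0 < ε →
      Tendsto (fun n : ℕ => ∑' k : ℕ, p n k *
          (if ε * Real.log n / μ n < ((Real.log k - μ n) / σ' n) ^ 2 then
            ((Real.log k - μ n) / σ' n) ^ 2 else 0)) atTop (nhds 0)) :
    LindebergSeq (fun n => pMeas (p n)) μ σ' := by
  have hprob : ∀ n, IsProbabilityMeasure (pMeas (p n)) := fun n =>
    isProbabilityMeasure_pMeas (hp0 n) (hpsum n)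
  have hi1 : ∀ n, Integrable (fun m : ℕ => Real.log m) (pMeas (p n)) := fun n => by
    refine integrable_pMeas (hp0 n) ((hsum1 n).congr fun k => ?_)
    rw [abs_of_nonneg (Real.log_natCast_nonneg k)]
  have hi2 : ∀ n, Integrable (fun m : ℕ => (Real.log m - μ n) ^ 2) (pMeas (p n)) := fun n => by
    refine integrable_pMeas (hp0 n) ((hsum2 n).congr fun k => ?_)
    rw [abs_of_nonneg (sq_nonneg _)]
  have hi3 : ∀ n, Integrable (fun m : ℕ => Real.log m ^ 2) (pMeas (p n)) := fun n => by
    have := hprob n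
    refine (((hi2 n).add ((hi1 n).const_mul (2 * μ n))).sub (integrable_const (μ n ^ 2))).congr
      (Eventually.of_forall fun m => ?_)
    simp only [Pi.add_apply, Pi.sub_apply]
    ring
  refine ⟨hprob, fun n => pMeas_singleton_zero (hpz n), hi3, hμpos, hσpos, fun n => ?_, fun n => ?_,
    fun ε hε => ?_⟩
  · rw [integral_pMeas (hp0 n) (hi1 n), hμ n]
  · rw [integral_pMeas (hp0 n) (hi2 n), hσ n]
  · refine (hLind ε hε).congr fun n => ?_
    have := hprob n
    rw [truncSq, integral_pMeas (hp0 n) (integrable_truncSq (hi3 n) _ _ _)]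

/-- Under the Lindeberg-type condition, the continuous-time `p_n`-shuffle family presents
an optimal `(t_n, b_n)` total variation cutoff with `t_n = 3 log n/(2 μ_n)` and
`b_n = μ_n⁻¹ max{(μ_n + σ_n)√(log n/μ_n), 1}`. -/
theorem continuous_time_pn_shuffle_cutoff (p : ℕ → ℕ → ℝ) (hp0 : ∀ n k, 0 ≤ p n k)
    (hpz : ∀ n, p n 0 = 0) (hpsum : ∀ n, ∑' k : ℕ, p n k = 1)
    (μ σ' : ℕ → ℝ) (hμpos : ∀ n, 0 < μ n) (hσpos : ∀ n, 0 < σ' n)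
    (hsum1 : ∀ n, Summable fun k : ℕ => p n k * Real.log k)
    (hμ : ∀ n, μ n = ∑' k : ℕ, p n k * Real.log k)
    (hsum2 : ∀ n, Summable fun k : ℕ => p n k * (Real.log k - μ n) ^ 2)
    (hσ : ∀ n, (σ' n) ^ 2 = ∑' k : ℕ, p n k * (Real.log k - μ n) ^ 2)
    (hLind : ∀ ε : ℝ, 0 < ε →
      Filter.Tendsto (fun n : ℕ => ∑' k : ℕ, p n k *
          (if ε * Real.log n / μ n < ((Real.log k - μ n) / σ' n) ^ 2 then
            ((Real.log k - μ n) / σ' n) ^ 2 else 0))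
        Filter.atTop (nhds 0))
    (t b : ℕ → ℝ) (ht : ∀ n, t n = 3 * Real.log n / (2 * μ n))
    (hb : ∀ n, b n = (1 / μ n) * max ((μ n + σ' n) * Real.sqrt (Real.log n / μ n)) 1) :
    Filter.Tendsto (fun n => b n / t n) Filter.atTop (nhds 0) ∧
    Filter.Tendsto (fun c : ℝ =>
      Filter.limsup (fun n : ℕ => tv n (Hp n (p n) (t n + c * b n)) (Us n)) Filter.atTop)
      Filter.atTop (nhds 0) ∧
    Filter.Tendsto (fun c : ℝ =>
      Filter.liminf (fun n : ℕ => tv n (Hp n (p n) (max (t n - c * b n) 0)) (Us n))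
        Filter.atTop) Filter.atTop (nhds 1) ∧
    (∀ c : ℝ, 0 < c →
      0 < Filter.liminf (fun n : ℕ => tv n (Hp n (p n) (t n + c * b n)) (Us n))
            Filter.atTop ∧
      Filter.limsup (fun n : ℕ => tv n (Hp n (p n) (max (t n - c * b n) 0)) (Us n))
        Filter.atTop < 1) := by
  have h := lindebergSeq_pMeas hp0 hpz hpsum hμpos hσpos hsum1 hμ hsum2 hσ hLind
  have htime : ∀ c n, t n + c * b n = windowTime μ σ' c n := fun c n => by
    rw [ht, hb]; rfl
  have htime' : ∀ c n, t n - c * b n = windowTime μ σ' (-c) n := fun c n => by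
    rw [← htime]; ring
  have hplus : ∀ c, (fun n => tv n (Hp n (p n) (t n + c * b n)) (Us n)) =ᶠ[atTop]
      windowTV (fun n => pMeas (p n)) μ σ' c := fun c => by
    filter_upwards [h.eventually_windowTime_pos c, eventually_ge_atTop 1] with n hn h1
    rw [htime, Hp_eq_mixQs h1 (hp0 n) (hpsum n) hn.le, windowTV]
  have hminus : ∀ c, (fun n => tv n (Hp n (p n) (max (t n - c * b n) 0)) (Us n)) =ᶠ[atTop]
      windowTV (fun n => pMeas (p n)) μ σ' (-c) := fun c => by
    filter_upwards [h.eventually_windowTime_pos (-c), eventually_ge_atTop 1] with n hn h1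
    rw [htime', max_eq_left hn.le, Hp_eq_mixQs h1 (hp0 n) (hpsum n) hn.le, windowTV]
  refine ⟨?_, ?_, ?_, fun c hc => ⟨?_, ?_⟩⟩
  · have h1 := h.tendsto_logWindow_div_log.const_mul (2 / 3)
    rw [mul_zero] at h1
    refine h1.congr' ?_
    filter_upwards [eventually_log_pos] with n hl
    have := hμpos n
    rw [ht, hb, ← logWindow]
    field_simp
  · simp_rw [fun c => limsup_congr (hplus c)]
    exact h.tendsto_limsup_windowTV
  · simp_rw [fun c => liminf_congr (hminus c)]
    exact h.tendsto_liminf_windowTV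
  · rw [liminf_congr (hplus c)]
    exact h.liminf_windowTV_pos hc
  · rw [limsup_congr (hminus c)]
    exact h.limsup_windowTV_lt_one hc
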